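/- arXiv:1301.7159 — 6 statements merged into one kernel-verified Lean document; each statement's English description precedes it below -/
import Mathlib

section
/- Let ν, a, s ∈ ℝ with ν ≠ 0 and s ≠ 0, and let r ∈ ℤ. Suppose that every solution x of the class-D equation with parameters (ν, a, s) satisfies x(2π) = x(0) + 2πr. Then there exists k ∈ ℤ with a = k such that r − k is even, and if k ≠ r then either r < k < 0 or 0 < k < r. -/
open Real

/-- A solution of the class-D equation `ẋ = ν sin x + a + s sin t`. -/
def IsClassDSolution (ν a s : ℝ) (x : ℝ → ℝ) : Prop :=
  ∀ t : ℝ, HasDerivAt x (ν * Real.sin (x t) + a + s * Real.sin t) t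

open Set Filter Topology

/-- The class-D equation has a global solution through every initial value at time `0`. -/
theorem exists_isClassDSolution (ν a s x₀ : ℝ) :
    ∃ x : ℝ → ℝ, IsClassDSolution ν a s x ∧ x 0 = x₀ := by
  have hlip : ∀ t : ℝ, LipschitzWith ‖ν‖₊ (fun y : ℝ => ν * Real.sin y + a + s * Real.sin t) := by
    intro t
    refine LipschitzWith.of_dist_le_mul fun y z => ?_
    have h : (ν * Real.sin y + a + s * Real.sin t) - (ν * Real.sin z + a + s * Real.sin t)
        = ν * (Real.sin y - Real.sin z) := by ring
    rw [Real.dist_eq, Real.dist_eq, h, abs_mul, coe_nnnorm, Real.norm_eq_abs]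
    exact mul_le_mul_of_nonneg_left (Real.abs_sin_sub_sin_le y z) (abs_nonneg ν)
  have hloc : ∀ n : ℕ, ∃ y : ℝ → ℝ, y 0 = x₀ ∧ ∀ t ∈ Ioo (-(n + 1) : ℝ) (n + 1),
      HasDerivAt y (ν * Real.sin (y t) + a + s * Real.sin t) t := by
    intro n
    have hn : (0 : ℝ) < n + 1 := by positivity
    have h0 : (0 : ℝ) ∈ Icc (-(n + 1) : ℝ) (n + 1) := ⟨by linarith, hn.le⟩
    set L : NNReal := ‖ν‖₊ + ‖a‖₊ + ‖s‖₊ with hL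
    have hPL : IsPicardLindelof (fun t y : ℝ => ν * Real.sin y + a + s * Real.sin t)
        (⟨0, h0⟩ : Icc (-(n + 1) : ℝ) (n + 1)) x₀ (L * (n + 1)) 0 L ‖ν‖₊ := by
      refine ⟨fun t _ => (hlip t).lipschitzOnWith, fun y _ => by fun_prop, fun t _ y _ => ?_, ?_⟩
      · have h1 := abs_mul ν (Real.sin y)
        have h2 := abs_mul s (Real.sin t)
        have h3 := mul_le_of_le_one_right (abs_nonneg ν) (Real.abs_sin_le_one y)
        have h4 := mul_le_of_le_one_right (abs_nonneg s) (Real.abs_sin_le_one t)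
        have h5 := abs_add_three (ν * Real.sin y) a (s * Real.sin t)
        simp only [hL, NNReal.coe_add, coe_nnnorm, Real.norm_eq_abs]
        linarith
      · simp
    obtain ⟨y, hy0, hy⟩ := hPL.exists_eq_forall_mem_Icc_hasDerivWithinAt₀
    exact ⟨y, hy0, fun t ht => (hy t (Ioo_subset_Icc_self ht)).hasDerivAt (Icc_mem_nhds ht.1 ht.2)⟩
  choose y hy0 hy using hloc
  have hmono : ∀ m n : ℕ, m ≤ n → EqOn (y m) (y n) (Ioo (-(m + 1) : ℝ) (m + 1)) := by
    intro m n hmn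
    have hmn' : (m : ℝ) ≤ n := by exact_mod_cast hmn
    have hm : (0 : ℝ) < m + 1 := by positivity
    refine ODE_solution_unique_of_mem_Ioo (s := fun _ => univ) (K := ‖ν‖₊)
      (v := fun t y : ℝ => ν * Real.sin y + a + s * Real.sin t) (t₀ := 0)
      (fun t _ => (hlip t).lipschitzOnWith) ⟨by linarith, hm⟩
      (fun t ht => ⟨hy m t ht, trivial⟩)
      (fun t ht => ⟨hy n t ⟨by linarith [ht.1], by linarith [ht.2]⟩, trivial⟩) ?_
    rw [hy0, hy0]
  have hfloor : ∀ t : ℝ, t ∈ Ioo (-((⌊|t|⌋₊ : ℝ) + 1)) ((⌊|t|⌋₊ : ℝ) + 1) := fun t =>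
    abs_lt.mp (Nat.lt_floor_add_one |t|)
  have hglue : ∀ (n : ℕ) (t : ℝ), t ∈ Ioo (-(n + 1) : ℝ) (n + 1) → y ⌊|t|⌋₊ t = y n t := by
    intro n t ht
    rcases le_total ⌊|t|⌋₊ n with h | h
    · exact hmono _ _ h (hfloor t)
    · exact (hmono _ _ h ht).symm
  refine ⟨fun t => y ⌊|t|⌋₊ t, fun t => ?_, by simp [hy0]⟩
  refine (hy _ t (hfloor t)).congr_of_eventuallyEq ?_
  filter_upwards [isOpen_Ioo.mem_nhds (hfloor t)] with τ hτ
  exact hglue _ τ hτ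

/-- A function satisfying a scalar linear differential inequality with positive initial value
stays positive. -/
theorem pos_of_hasDerivAt_linear {d c g : ℝ → ℝ} (hc : Continuous c) (hg : ∀ t, 0 ≤ g t)
    (hd : ∀ t, HasDerivAt d (c t * d t + g t) t) (h0 : 0 < d 0) {T : ℝ} (hT : 0 ≤ T) :
    0 < d T := by
  have hI : ∀ t, HasDerivAt (fun t => ∫ τ in (0 : ℝ)..t, c τ) (c t) t := fun t =>
    intervalIntegral.integral_hasDerivAt_right (hc.intervalIntegrable _ _)
      hc.stronglyMeasurable.stronglyMeasurableAtFilter hc.continuousAt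
  have hD : ∀ t, HasDerivAt (fun t => d t * Real.exp (-∫ τ in (0 : ℝ)..t, c τ))
      (g t * Real.exp (-∫ τ in (0 : ℝ)..t, c τ)) t := by
    intro t
    refine ((hd t).mul (hI t).fun_neg.exp).congr_deriv ?_
    ring
  have hm : Monotone (fun t => d t * Real.exp (-∫ τ in (0 : ℝ)..t, c τ)) :=
    monotone_of_hasDerivAt_nonneg hD fun t => mul_nonneg (hg t) (Real.exp_pos _).le
  have h := hm hT
  simp only [intervalIntegral.integral_same, neg_zero, Real.exp_zero, mul_one] at h
  exact pos_of_mul_pos_left (h0.trans_le h) (Real.exp_pos _).le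

/-- A constriction with non-positive abscissa has non-positive rotation number. -/
theorem rotation_nonpos_of_abscissa_nonpos {ν a s : ℝ} {r : ℤ} (ha : a ≤ 0)
    (hconstr : ∀ x : ℝ → ℝ, IsClassDSolution ν a s x → x (2 * π) = x 0 + 2 * π * (r : ℝ)) :
    r ≤ 0 := by
  obtain ⟨x, hx, -⟩ := exists_isClassDSolution ν a s 0
  have hback : x 0 = x (-(2 * π)) + 2 * π * r := by
    have h := hconstr (fun t => x (t - 2 * π)) fun t => by
      have h1 := (hx (t - 2 * π)).comp_sub_const t (2 * π)
      rwa [Real.sin_sub_two_pi] at h1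
    simpa using h
  have hxc : Continuous x := continuous_iff_continuousAt.mpr fun t => (hx t).continuousAt
  set d : ℝ → ℝ := fun t => x (-t) + π - x t with hd
  have hder : ∀ t, HasDerivAt d
      (ν * Real.cos ((x (-t) + π + x t) / 2) * Real.sinc (d t / 2) * d t + -(2 * a)) t := by
    intro t
    have h1 : HasDerivAt (fun t => x (-t)) (-(ν * Real.sin (x (-t)) + a + s * Real.sin (-t))) t := by
      refine ((hx (-t)).comp t (hasDerivAt_neg t)).congr_deriv ?_
      ring
    refine ((h1.add_const π).sub (hx t)).congr_deriv ?_
    have h2 : Real.sinc (d t / 2) * d t = 2 * Real.sin (d t / 2) := by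
      by_cases h : d t = 0
      · simp [h]
      · rw [Real.sinc_of_ne_zero (by simpa using h)]
        field_simp
    have h3 : Real.sin (x (-t) + π) - Real.sin (x t)
        = 2 * Real.sin (d t / 2) * Real.cos ((x (-t) + π + x t) / 2) := Real.sin_sub_sin _ _
    rw [mul_assoc, h2, Real.sin_neg]
    rw [Real.sin_add_pi] at h3
    linear_combination ν * h3
  have hpos : 0 < d (2 * π) := by
    refine pos_of_hasDerivAt_linear (g := fun _ => -(2 * a)) ?_ (fun _ => by linarith) hder ?_
      Real.two_pi_pos.le
    · have : Continuous d := by fun_prop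
      have h := Real.continuous_sinc.comp (this.div_const 2)
      exact (by fun_prop : Continuous fun t => ν * Real.cos ((x (-t) + π + x t) / 2)).mul h
    · simp [hd, Real.pi_pos]
  have h1 := hconstr x hx
  by_contra! hr
  have hr' : (1 : ℝ) ≤ r := by exact_mod_cast hr
  simp only [hd] at hpos
  nlinarith [Real.pi_pos]

/-- A continuous real function with equal values at `0` and `2π` is uniformly approximated by real
parts of polynomials on the unit circle. -/
theorem exists_polynomial_re_near {θ : ℝ → ℝ} (hθ : Continuous θ) (hper : θ 0 = θ (2 * π))
    {ε : ℝ} (hε : 0 < ε) :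
    ∃ R : Polynomial ℂ, ∀ t ∈ Ico 0 (2 * π), |θ t - (R.eval (Complex.exp (t * Complex.I))).re| < ε := by
  have : Fact (0 < 2 * π) := ⟨Real.two_pi_pos⟩
  let f : C(AddCircle (2 * π), ℂ) := ⟨AddCircle.liftIco (2 * π) 0 (fun t => (θ t : ℂ)),
    AddCircle.liftIco_zero_continuous (by simp [hper]) (by fun_prop)⟩
  have hfapply : ∀ t ∈ Ico 0 (2 * π), f t = θ t := fun t ht =>
    AddCircle.liftIco_zero_coe_apply (f := fun t => (θ t : ℂ)) ht
  have hf : f ∈ (Submodule.span ℂ (range <| @fourier (2 * π))).topologicalClosure := by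
    rw [span_fourier_closure_eq_top]; trivial
  obtain ⟨g, hg, hfg⟩ := Metric.mem_closure_iff.mp hf ε hε
  have hpoly : ∃ P Q : Polynomial ℂ, ∀ t : ℝ, g (t : AddCircle (2 * π)) =
      P.eval (Complex.exp (t * Complex.I))
        + (starRingEnd ℂ) (Q.eval (Complex.exp (t * Complex.I))) := by
    clear hfg
    induction hg using Submodule.span_induction with
    | mem g hg =>
      obtain ⟨n, rfl⟩ := hg
      have key : ∀ (m : ℕ) (t : ℝ), fourier (m : ℤ) (t : AddCircle (2 * π))
          = Complex.exp (t * Complex.I) ^ m := by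
        intro m t
        rw [fourier_coe_apply, ← Complex.exp_nat_mul]
        congr 1
        have : (π : ℂ) ≠ 0 := by exact_mod_cast Real.pi_ne_zero
        push_cast
        field_simp
      obtain ⟨m, rfl | rfl⟩ := n.eq_nat_or_neg
      · exact ⟨Polynomial.X ^ m, 0, fun t => by simp [key]⟩
      · exact ⟨0, Polynomial.X ^ m, fun t => by rw [fourier_neg, key]; simp⟩
    | zero => exact ⟨0, 0, fun t => by simp⟩
    | add g₁ g₂ _ _ h₁ h₂ =>
      obtain ⟨P₁, Q₁, h₁⟩ := h₁
      obtain ⟨P₂, Q₂, h₂⟩ := h₂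
      refine ⟨P₁ + P₂, Q₁ + Q₂, fun t => ?_⟩
      simp only [ContinuousMap.add_apply, h₁, h₂, Polynomial.eval_add, map_add]
      ring
    | smul c g _ h =>
      obtain ⟨P, Q, h⟩ := h
      refine ⟨Polynomial.C c * P, Polynomial.C ((starRingEnd ℂ) c) * Q, fun t => ?_⟩
      simp only [ContinuousMap.smul_apply, h, Polynomial.eval_mul, Polynomial.eval_C, map_mul,
        Complex.conj_conj, smul_eq_mul]
      ring
  obtain ⟨P, Q, hPQ⟩ := hpoly
  refine ⟨P + Q, fun t ht => ?_⟩
  have h1 : ‖f t - g t‖ < ε := by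
    rw [← dist_eq_norm]
    exact (ContinuousMap.dist_apply_le_dist _).trans_lt hfg
  have h2 := hfapply t ht
  have h3 := (Complex.abs_re_le_norm (f t - g t)).trans_lt h1
  rw [h2, hPQ] at h3
  simpa using h3

/-- If the Fourier coefficients of `w` against `e^{ilt}`, `l ≥ 0`, vanish, then so does the
integral of `w` against the exponential of any polynomial in `e^{it}`. -/
theorem integral_mul_exp_polynomial_eq_zero {w : ℝ → ℂ} (hw : Continuous w)
    (h : ∀ l : ℕ, ∫ t in (0 : ℝ)..2 * π, w t * Complex.exp (t * Complex.I) ^ l = 0)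
    (P : Polynomial ℂ) :
    ∫ t in (0 : ℝ)..2 * π, w t * Complex.exp (P.eval (Complex.exp (t * Complex.I))) = 0 := by
  have hpoly : ∀ Q : Polynomial ℂ,
      ∫ t in (0 : ℝ)..2 * π, w t * Q.eval (Complex.exp (t * Complex.I)) = 0 := by
    intro Q
    induction Q using Polynomial.induction_on' with
    | add p q hp hq =>
      simp only [Polynomial.eval_add, mul_add]
      rw [intervalIntegral.integral_add, hp, hq, add_zero]
      all_goals exact Continuous.intervalIntegrable (by fun_prop) _ _
    | monomial n c =>
      simp only [Polynomial.eval_monomial]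
      simp_rw [mul_left_comm _ c]
      rw [intervalIntegral.integral_const_mul, h, mul_zero]
  obtain ⟨M, hM⟩ := (isCompact_Icc (a := (0 : ℝ)) (b := 2 * π)).exists_bound_of_continuousOn
    (f := fun t : ℝ => P.eval (Complex.exp (t * Complex.I))) (by fun_prop)
  obtain ⟨B, hB⟩ := (isCompact_Icc (a := (0 : ℝ)) (b := 2 * π)).exists_bound_of_continuousOn
    hw.continuousOn
  have hsum := intervalIntegral.hasSum_integral_of_dominated_convergence
    (μ := MeasureTheory.volume) (a := 0) (b := 2 * π)
    (F := fun (n : ℕ) (t : ℝ) =>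
      w t * ((n.factorial : ℂ)⁻¹ * P.eval (Complex.exp (t * Complex.I)) ^ n))
    (f := fun t => w t * Complex.exp (P.eval (Complex.exp (t * Complex.I))))
    (fun n _ => B * ((n.factorial : ℝ)⁻¹ * M ^ n))
    (fun n => (by fun_prop : Continuous _).aestronglyMeasurable)
    (fun n => Eventually.of_forall fun t ht => ?_)
    (Eventually.of_forall fun t ht => ?_) ?_ (Eventually.of_forall fun t ht => ?_)
  · refine hsum.unique ?_
    convert hasSum_zero with n
    have := hpoly (Polynomial.C (n.factorial : ℂ)⁻¹ * P ^ n)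
    simpa only [Polynomial.eval_mul, Polynomial.eval_C, Polynomial.eval_pow] using this
  · rw [uIoc_of_le Real.two_pi_pos.le] at ht
    have h1 := hM t (Ioc_subset_Icc_self ht)
    have h2 := hB t (Ioc_subset_Icc_self ht)
    have h3 : 0 ≤ B := (norm_nonneg _).trans h2
    rw [norm_mul, norm_mul, norm_pow, norm_inv, Complex.norm_natCast]
    gcongr
  · refine (Summable.mul_left B ?_)
    have := Real.summable_pow_div_factorial M
    refine this.congr fun n => ?_
    rw [div_eq_inv_mul]
  · simp
  · refine HasSum.mul_left _ ?_
    have := NormedSpace.expSeries_div_hasSum_exp (P.eval (Complex.exp (t * Complex.I)))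
    rw [← Complex.exp_eq_exp_ℂ] at this
    simpa only [div_eq_inv_mul] using this

/-- A function on the circle which stays within angle `π / 2` of a function of argument `θ` of
degree zero has a non-vanishing Fourier coefficient of non-positive index. -/
theorem exists_integral_mul_exp_pow_ne_zero {w : ℝ → ℂ} {θ : ℝ → ℝ} (hw : Continuous w)
    (hθ : Continuous θ) (hper : θ 0 = θ (2 * π))
    (hpos : ∀ t, 0 < (w t * Complex.exp (-(θ t * Complex.I))).re) :
    ∃ l : ℕ, ∫ t in (0 : ℝ)..2 * π, w t * Complex.exp (t * Complex.I) ^ l ≠ 0 := by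
  by_contra! hzero
  have hne : (Icc (0 : ℝ) (2 * π)).Nonempty := nonempty_Icc.mpr Real.two_pi_pos.le
  obtain ⟨t₀, -, ht₀⟩ := isCompact_Icc.exists_isMinOn hne
    (f := fun t => (w t * Complex.exp (-(θ t * Complex.I))).re)
    (Continuous.continuousOn (by fun_prop))
  set δ := (w t₀ * Complex.exp (-(θ t₀ * Complex.I))).re with hδ
  have hδ0 : 0 < δ := hpos t₀
  obtain ⟨B, hB⟩ := (isCompact_Icc (a := (0 : ℝ)) (b := 2 * π)).exists_bound_of_continuousOn
    hw.continuousOn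
  have hB0 : 0 ≤ B := (norm_nonneg _).trans (hB 0 ⟨le_rfl, Real.two_pi_pos.le⟩)
  obtain ⟨R, hR⟩ := exists_polynomial_re_near hθ hper (ε := δ / (B + 1)) (by positivity)
  have hint := integral_mul_exp_polynomial_eq_zero hw hzero (Polynomial.C (-Complex.I) * R)
  have hre : 0 < ∫ t in (0 : ℝ)..2 * π, (w t * Complex.exp
      ((Polynomial.C (-Complex.I) * R).eval (Complex.exp (t * Complex.I)))).re := by
    refine intervalIntegral.intervalIntegral_pos_of_pos_on
      (Continuous.intervalIntegrable (by fun_prop) _ _) (fun t ht => ?_) Real.two_pi_pos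
    set z := R.eval (Complex.exp (t * Complex.I)) with hz
    have h1 : |θ t - z.re| < δ / (B + 1) := hR t (Ioo_subset_Ico_self ht)
    have h2 : δ ≤ (w t * Complex.exp (-(θ t * Complex.I))).re := ht₀ (Ioo_subset_Icc_self ht)
    have h3 := hB t (Ioo_subset_Icc_self ht)
    have hsplit : w t * Complex.exp ((Polynomial.C (-Complex.I) * R).eval
        (Complex.exp (t * Complex.I))) = (Real.exp z.im : ℂ) *
        (w t * Complex.exp (-(θ t * Complex.I)) +
          w t * Complex.exp (-(θ t * Complex.I)) *
            (Complex.exp (Complex.I * ((θ t - z.re : ℝ) : ℂ)) - 1)) := by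
      rw [Polynomial.eval_mul, Polynomial.eval_C, ← hz, Complex.ofReal_exp]
      have : Complex.exp (-Complex.I * z) = Complex.exp z.im * (Complex.exp (-(θ t * Complex.I)) *
          Complex.exp (Complex.I * ((θ t - z.re : ℝ) : ℂ))) := by
        rw [← Complex.exp_add, ← Complex.exp_add]
        congr 1
        conv_lhs => rw [← Complex.re_add_im z]
        push_cast
        linear_combination (-(z.im : ℂ)) * Complex.I_mul_I
      rw [this]
      ring
    rw [hsplit, Complex.re_ofReal_mul, Complex.add_re]
    refine mul_pos (Real.exp_pos _) ?_
    have h4 : ‖w t * Complex.exp (-(θ t * Complex.I)) *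
        (Complex.exp (Complex.I * ((θ t - z.re : ℝ) : ℂ)) - 1)‖ < δ := by
      have h5 : ‖Complex.exp (-(θ t * Complex.I))‖ = 1 := by
        rw [← neg_mul, ← Complex.ofReal_neg, Complex.norm_exp_ofReal_mul_I]
      have h6 : ‖Complex.exp (Complex.I * ((θ t - z.re : ℝ) : ℂ)) - 1‖ ≤ ‖θ t - z.re‖ :=
        Real.norm_exp_I_mul_ofReal_sub_one_le
      rw [norm_mul, norm_mul, h5, mul_one]
      calc _ ≤ B * ‖θ t - z.re‖ := mul_le_mul h3 h6 (norm_nonneg _) hB0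
        _ ≤ B * (δ / (B + 1)) := by gcongr; exact h1.le
        _ < δ := by
          rw [mul_div_assoc', div_lt_iff₀ (by positivity)]
          linarith
    have h7 := Complex.abs_re_le_norm (w t * Complex.exp (-(θ t * Complex.I)) *
        (Complex.exp (Complex.I * ((θ t - z.re : ℝ) : ℂ)) - 1))
    have h8 := neg_abs_le (w t * Complex.exp (-(θ t * Complex.I)) *
        (Complex.exp (Complex.I * ((θ t - z.re : ℝ) : ℂ)) - 1)).re
    linarith
  have hcomm := Complex.reCLM.intervalIntegral_comp_comm (μ := MeasureTheory.volume)
    (a := 0) (b := 2 * π) (f := fun t : ℝ => w t * Complex.exp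
      ((Polynomial.C (-Complex.I) * R).eval (Complex.exp (t * Complex.I))))
    (Continuous.intervalIntegrable (by fun_prop) _ _)
  simp only [Complex.reCLM_apply] at hcomm
  rw [hcomm, hint] at hre
  simp at hre

/-- The linear system whose projectivization in the coordinate `v / u = e^{ix}` is the class-D
equation. -/
structure IsLinearSolution (ν a s : ℝ) (u v : ℝ → ℂ) : Prop where
  hasDerivAt_fst : ∀ t, HasDerivAt u (-(ν / 2) * v t) t
  hasDerivAt_snd : ∀ t : ℝ, HasDerivAt v
    ((a + s * Complex.sin t) * Complex.I * v t - ν / 2 * u t) t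

namespace IsLinearSolution

variable {ν a s : ℝ} {u v u₁ v₁ u₂ v₂ : ℝ → ℂ}

theorem continuous_fst (h : IsLinearSolution ν a s u v) : Continuous u :=
  continuous_iff_continuousAt.mpr fun t => (h.hasDerivAt_fst t).continuousAt

theorem continuous_snd (h : IsLinearSolution ν a s u v) : Continuous v :=
  continuous_iff_continuousAt.mpr fun t => (h.hasDerivAt_snd t).continuousAt

theorem linearCombination (h₁ : IsLinearSolution ν a s u₁ v₁) (h₂ : IsLinearSolution ν a s u₂ v₂)
    (c₁ c₂ : ℂ) : IsLinearSolution ν a s (fun t => c₁ * u₁ t + c₂ * u₂ t)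
      (fun t => c₁ * v₁ t + c₂ * v₂ t) where
  hasDerivAt_fst t := by
    refine (((h₁.hasDerivAt_fst t).const_mul c₁).add
      ((h₂.hasDerivAt_fst t).const_mul c₂)).congr_deriv ?_
    ring
  hasDerivAt_snd t := by
    refine (((h₁.hasDerivAt_snd t).const_mul c₁).add
      ((h₂.hasDerivAt_snd t).const_mul c₂)).congr_deriv ?_
    ring

/-- The indefinite Hermitian form `|u|² - |v|²` is conserved. -/
theorem normSq_sub_normSq (h : IsLinearSolution ν a s u v) (t : ℝ) :
    Complex.normSq (u t) - Complex.normSq (v t)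
      = Complex.normSq (u 0) - Complex.normSq (v 0) := by
  have hd : ∀ t, HasDerivAt (fun t => u t * star (u t) - v t * star (v t)) 0 t := by
    intro t
    refine (((h.hasDerivAt_fst t).mul (h.hasDerivAt_fst t).star).sub
      ((h.hasDerivAt_snd t).mul (h.hasDerivAt_snd t).star)).congr_deriv ?_
    have hsin : (starRingEnd ℂ) (Complex.sin t) = Complex.sin t := by
      rw [← Complex.ofReal_sin, Complex.conj_ofReal]
    simp only [Complex.star_def, map_mul, map_neg, map_sub, map_add, map_div₀, Complex.conj_ofReal,
      Complex.conj_I, map_ofNat, hsin]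
    ring
  have hconst := is_const_of_deriv_eq_zero (fun t => (hd t).differentiableAt)
    (fun t => (hd t).deriv) t 0
  simp only [Complex.star_def, Complex.mul_conj] at hconst
  exact_mod_cast hconst

end IsLinearSolution

/-- The unnormalized Fourier coefficient of `f` on `[0, 2π]` at the real frequency `m`. -/
noncomputable def coeff (f : ℝ → ℂ) (m : ℝ) : ℂ :=
  ∫ t in (0 : ℝ)..2 * π, f t * Complex.exp (-(m * t * Complex.I))

theorem coeff_linearCombination {f g : ℝ → ℂ} (hf : Continuous f) (hg : Continuous g) (c d : ℂ)
    (m : ℝ) : coeff (fun t => c * f t + d * g t) m = c * coeff f m + d * coeff g m := by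
  unfold coeff
  rw [← intervalIntegral.integral_const_mul, ← intervalIntegral.integral_const_mul,
    ← intervalIntegral.integral_add]
  · congr 1
    ext t
    ring
  all_goals exact Continuous.intervalIntegrable (by fun_prop) _ _

theorem norm_exp_neg_mul_I (m t : ℝ) : ‖Complex.exp (-(m * t * Complex.I))‖ = 1 := by
  rw [show -((m : ℂ) * t * Complex.I) = ((-(m * t) : ℝ) : ℂ) * Complex.I by push_cast; ring,
    Complex.norm_exp_ofReal_mul_I]

/-- Fourier coefficients of a continuous function are uniformly bounded. -/
theorem exists_norm_coeff_le {f : ℝ → ℂ} (hf : Continuous f) : ∃ B, ∀ m, ‖coeff f m‖ ≤ B := by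
  obtain ⟨C, hC⟩ := (isCompact_Icc (a := (0 : ℝ)) (b := 2 * π)).exists_bound_of_continuousOn
    hf.continuousOn
  refine ⟨C * |2 * π - 0|, fun m => intervalIntegral.norm_integral_le_of_norm_le_const fun t ht => ?_⟩
  rw [uIoc_of_le Real.two_pi_pos.le] at ht
  rw [norm_mul, norm_exp_neg_mul_I, mul_one]
  exact hC t (Ioc_subset_Icc_self ht)

/-- Differentiation multiplies the Fourier coefficients of a function with multiplier
`e^{2πim}` by `im`. -/
theorem coeff_deriv {f f' : ℝ → ℂ} (hf : ∀ t, HasDerivAt f (f' t) t) (hf' : Continuous f') {m : ℝ}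
    (hper : f (2 * π) = Complex.exp (2 * π * m * Complex.I) * f 0) :
    coeff f' m = m * Complex.I * coeff f m := by
  have hfc : Continuous f := continuous_iff_continuousAt.mpr fun t => (hf t).continuousAt
  have he : ∀ t : ℝ, HasDerivAt (fun t : ℝ => Complex.exp (-(m * t * Complex.I)))
      (Complex.exp (-(m * t * Complex.I)) * -(m * Complex.I)) t := by
    intro t
    have h1 : HasDerivAt (fun t : ℝ => (t : ℂ)) 1 t := Complex.ofRealCLM.hasDerivAt
    refine ((h1.const_mul (m : ℂ)).mul_const Complex.I).fun_neg.cexp.congr_deriv ?_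
    ring
  have h := intervalIntegral.integral_deriv_mul_eq_sub (a := 0) (b := 2 * π)
    (fun t _ => hf t) (fun t _ => he t) (hf'.intervalIntegrable _ _)
    (Continuous.intervalIntegrable (by fun_prop) _ _)
  have hbdry : f (2 * π) * Complex.exp (-(m * (2 * π : ℝ) * Complex.I))
      - f 0 * Complex.exp (-(m * (0 : ℝ) * Complex.I)) = 0 := by
    have : Complex.exp (2 * π * m * Complex.I) * Complex.exp (-(m * (2 * π : ℝ) * Complex.I))
        = 1 := by
      rw [← Complex.exp_add, ← Complex.exp_zero]
      congr 1
      push_cast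
      ring
    rw [hper]
    simp only [Complex.ofReal_zero, mul_zero, zero_mul, neg_zero, Complex.exp_zero]
    linear_combination f 0 * this
  rw [hbdry, intervalIntegral.integral_add (Continuous.intervalIntegrable (by fun_prop) _ _)
    (Continuous.intervalIntegrable (by fun_prop) _ _)] at h
  have h2 : ∫ t in (0 : ℝ)..2 * π, f t * (Complex.exp (-(m * t * Complex.I)) * -(m * Complex.I))
      = -(m * Complex.I) * coeff f m := by
    unfold coeff
    rw [← intervalIntegral.integral_const_mul]
    congr 1
    ext t
    ring
  rw [h2] at h
  unfold coeff at h ⊢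
  linear_combination h

theorem coeff_sin_mul {f : ℝ → ℂ} (hf : Continuous f) (m : ℝ) :
    coeff (fun t => Complex.sin t * Complex.I * f t) m
      = (coeff f (m - 1) - coeff f (m + 1)) / 2 := by
  unfold coeff
  rw [← intervalIntegral.integral_sub (Continuous.intervalIntegrable (by fun_prop) _ _)
    (Continuous.intervalIntegrable (by fun_prop) _ _), ← intervalIntegral.integral_div]
  congr 1
  ext t
  have h1 : Complex.exp (-(((m - 1 : ℝ) : ℂ) * t * Complex.I))
      = Complex.exp (-(m * t * Complex.I)) * Complex.exp (t * Complex.I) := by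
    rw [← Complex.exp_add]
    congr 1
    push_cast
    ring
  have h2 : Complex.exp (-(((m + 1 : ℝ) : ℂ) * t * Complex.I))
      = Complex.exp (-(m * t * Complex.I)) * Complex.exp (-t * Complex.I) := by
    rw [← Complex.exp_add]
    congr 1
    push_cast
    ring
  have h3 : Complex.sin t
      = (Complex.exp (-t * Complex.I) - Complex.exp (t * Complex.I)) * Complex.I / 2 := rfl
  beta_reduce
  rw [h1, h2, h3]
  linear_combination (f t * Complex.exp (-(m * t * Complex.I)) / 2 *
    (Complex.exp (-t * Complex.I) - Complex.exp (t * Complex.I))) * Complex.I_mul_I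

namespace IsLinearSolution

variable {ν a s : ℝ} {u v : ℝ → ℂ}

theorem coeff_fst_eq (h : IsLinearSolution ν a s u v) {m : ℝ}
    (hu : u (2 * π) = Complex.exp (2 * π * m * Complex.I) * u 0) :
    m * Complex.I * coeff u m = -(ν / 2) * coeff v m := by
  have hv := h.continuous_snd
  rw [← coeff_deriv h.hasDerivAt_fst (by fun_prop) hu]
  have := coeff_linearCombination hv hv (-(ν / 2)) 0 m
  simpa using this

theorem coeff_snd_eq (h : IsLinearSolution ν a s u v) {m : ℝ}
    (hv : v (2 * π) = Complex.exp (2 * π * m * Complex.I) * v 0) :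
    (m - a) * Complex.I * coeff v m
      = s / 2 * (coeff v (m - 1) - coeff v (m + 1)) - ν / 2 * coeff u m := by
  have hvc := h.continuous_snd
  have huc := h.continuous_fst
  have h1 := coeff_deriv h.hasDerivAt_snd (by fun_prop) hv
  have h2 := coeff_linearCombination (f := fun t : ℝ => Complex.sin t * Complex.I * v t)
    (g := fun t : ℝ => a * Complex.I * v t + -(ν / 2) * u t) (by fun_prop) (by fun_prop) s 1 m
  rw [coeff_linearCombination hvc huc, coeff_sin_mul hvc] at h2
  have h3 : (fun t : ℝ => ((a : ℂ) + s * Complex.sin t) * Complex.I * v t - ν / 2 * u t)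
      = fun t : ℝ => (s : ℂ) * (Complex.sin t * Complex.I * v t)
        + 1 * (a * Complex.I * v t + -(ν / 2) * u t) := by
    ext t
    ring
  rw [h3, h2] at h1
  linear_combination -h1

end IsLinearSolution

/-- A linear system of two homogeneous equations with vanishing determinant in two unknowns has a
non-trivial solution. -/
theorem exists_ne_zero_of_det_eq_zero {p q p' q' : ℂ} (h : p' * q - p * q' = 0) :
    ∃ c d : ℂ, (c ≠ 0 ∨ d ≠ 0) ∧ c * p + d * q = 0 ∧ c * p' + d * q' = 0 := by
  by_cases h1 : p = 0 ∧ q = 0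
  · by_cases h2 : p' = 0 ∧ q' = 0
    · exact ⟨1, 0, by simp, by simp [h1.1], by simp [h2.1]⟩
    · refine ⟨q', -p', ?_, by simp [h1.1, h1.2], by ring⟩
      rw [neg_ne_zero]
      tauto
  · refine ⟨q, -p, ?_, by ring, by linear_combination h⟩
    rw [neg_ne_zero]
    tauto

theorem exp_two_pi_mul_add_int (β : ℝ) (j : ℤ) :
    Complex.exp (2 * π * ((β + j : ℝ) : ℂ) * Complex.I)
      = Complex.exp (2 * π * β * Complex.I) := by
  rw [← Complex.exp_periodic.int_mul j (2 * π * β * Complex.I)]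
  congr 1
  push_cast
  ring

namespace IsLinearSolution

variable {ν a s β : ℝ} {u v u₁ v₁ u₂ v₂ : ℝ → ℂ}

/-- For a non-integer Floquet exponent, two consecutive vanishing coefficients of the second
component force all coefficients to vanish. -/
theorem coeff_eq_zero_of_consecutive (hs : s ≠ 0) (h : IsLinearSolution ν a s u v)
    (hu : u (2 * π) = Complex.exp (2 * π * β * Complex.I) * u 0)
    (hv : v (2 * π) = Complex.exp (2 * π * β * Complex.I) * v 0)
    (hβ : ∀ j : ℤ, β + j ≠ 0) (h0 : coeff v β = 0) (h1 : coeff v (β + 1) = 0) (j : ℤ) :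
    coeff u (β + j) = 0 ∧ coeff v (β + j) = 0 := by
  have hsC : (s : ℂ) ≠ 0 := by exact_mod_cast hs
  have hrec1 : ∀ j : ℤ, ((β + j : ℝ) : ℂ) * Complex.I * coeff u (β + j)
      = -(ν / 2) * coeff v (β + j) := fun j =>
    h.coeff_fst_eq (by rw [exp_two_pi_mul_add_int]; exact hu)
  have hrec2 := fun j : ℤ => h.coeff_snd_eq (m := β + j) (by rw [exp_two_pi_mul_add_int]; exact hv)
  have hU : ∀ j : ℤ, coeff v (β + j) = 0 → coeff u (β + j) = 0 := by
    intro j hj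
    have := hrec1 j
    rw [hj, mul_zero, mul_eq_zero, mul_eq_zero] at this
    have hm : ((β + j : ℝ) : ℂ) ≠ 0 := by exact_mod_cast hβ j
    rcases this with (h' | h') | h'
    · exact absurd h' hm
    · exact absurd h' Complex.I_ne_zero
    · exact h'
  have hV : ∀ j : ℤ, coeff v (β + j) = 0 ∧ coeff v (β + j + 1) = 0 := by
    intro j
    induction j using Int.induction_on with
    | zero => simpa using ⟨h0, h1⟩
    | succ i ih =>
      have h2 := hrec2 (i + 1)
      have e1 : β + ((i : ℤ) + 1 : ℤ) = β + (i : ℤ) + 1 := by push_cast; ring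
      have hU' := hU (i + 1) (by rw [e1]; exact ih.2)
      rw [hU', e1, ih.2, add_sub_cancel_right, ih.1] at h2
      rw [e1]
      refine ⟨ih.2, ?_⟩
      simpa [hsC] using h2
    | pred i ih =>
      have h2 := hrec2 (-i)
      have e1 : β + (-(i : ℤ) - 1 : ℤ) = β + (-(i : ℤ) : ℤ) - 1 := by push_cast; ring
      rw [hU _ ih.1, ih.1, ih.2] at h2
      rw [e1, sub_add_cancel]
      refine ⟨?_, ih.1⟩
      simpa [hsC] using h2
  exact ⟨hU j (hV j).1, (hV j).1⟩

/-- The coefficients of the second component decay at least like the inverse of the frequency. -/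
theorem exists_norm_coeff_snd_mul_le (h : IsLinearSolution ν a s u v)
    (hv : v (2 * π) = Complex.exp (2 * π * β * Complex.I) * v 0) :
    ∃ D, ∀ j : ℤ, |β + j - a| * ‖coeff v (β + j)‖ ≤ D := by
  obtain ⟨B, hB⟩ := exists_norm_coeff_le h.continuous_fst
  obtain ⟨B', hB'⟩ := exists_norm_coeff_le h.continuous_snd
  refine ⟨|s| / 2 * (B' + B') + |ν| / 2 * B, fun j => ?_⟩
  have h2 := h.coeff_snd_eq (m := β + j) (by rw [exp_two_pi_mul_add_int]; exact hv)
  have h3 : ‖(((β + j : ℝ) : ℂ) - a) * Complex.I * coeff v (β + j)‖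
      = |β + j - a| * ‖coeff v (β + j)‖ := by
    rw [norm_mul, norm_mul, Complex.norm_I, mul_one, ← Complex.ofReal_sub, Complex.norm_real,
      Real.norm_eq_abs]
  rw [← h3, h2]
  refine (norm_sub_le _ _).trans (add_le_add ?_ ?_)
  · rw [norm_mul]
    refine mul_le_mul (by simp) ((norm_sub_le _ _).trans (add_le_add (hB' _) (hB' _)))
      (norm_nonneg _) (by positivity)
  · rw [norm_mul]
    refine mul_le_mul (by simp) (hB _) (norm_nonneg _) (by positivity)

/-- For a non-integer Floquet exponent, the Casoratian of two solutions vanishes. -/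
theorem casoratian_eq_zero (hs : s ≠ 0) (h₁ : IsLinearSolution ν a s u₁ v₁)
    (h₂ : IsLinearSolution ν a s u₂ v₂)
    (hu₁ : u₁ (2 * π) = Complex.exp (2 * π * β * Complex.I) * u₁ 0)
    (hv₁ : v₁ (2 * π) = Complex.exp (2 * π * β * Complex.I) * v₁ 0)
    (hu₂ : u₂ (2 * π) = Complex.exp (2 * π * β * Complex.I) * u₂ 0)
    (hv₂ : v₂ (2 * π) = Complex.exp (2 * π * β * Complex.I) * v₂ 0)
    (hβ : ∀ j : ℤ, β + j ≠ 0) :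
    coeff v₁ (β + 1) * coeff v₂ β - coeff v₁ β * coeff v₂ (β + 1) = 0 := by
  have hsC : (s : ℂ) ≠ 0 := by exact_mod_cast hs
  set W : ℤ → ℂ := fun j =>
    coeff v₁ (β + j + 1) * coeff v₂ (β + j) - coeff v₁ (β + j) * coeff v₂ (β + j + 1) with hW
  have hstep : ∀ j : ℤ, W (j + 1) = -W j := by
    intro j
    have hm : ((β + (j + 1 : ℤ) : ℝ) : ℂ) ≠ 0 := by exact_mod_cast hβ (j + 1)
    have e₁ := h₁.coeff_fst_eq (m := β + (j + 1 : ℤ)) (by rw [exp_two_pi_mul_add_int]; exact hu₁)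
    have f₁ := h₁.coeff_snd_eq (m := β + (j + 1 : ℤ)) (by rw [exp_two_pi_mul_add_int]; exact hv₁)
    have e₂ := h₂.coeff_fst_eq (m := β + (j + 1 : ℤ)) (by rw [exp_two_pi_mul_add_int]; exact hu₂)
    have f₂ := h₂.coeff_snd_eq (m := β + (j + 1 : ℤ)) (by rw [exp_two_pi_mul_add_int]; exact hv₂)
    have em : β + (j : ℝ) = β + (j + 1 : ℤ) - 1 := by push_cast; ring
    simp only [hW]
    rw [em, sub_add_cancel]
    set m := β + (j + 1 : ℤ)
    have hfac : (m : ℂ) * Complex.I * s ≠ 0 :=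
      mul_ne_zero (mul_ne_zero hm Complex.I_ne_zero) hsC
    refine mul_left_cancel₀ hfac ?_
    linear_combination (2 * m * Complex.I * coeff v₂ m) * f₁ - (2 * m * Complex.I * coeff v₁ m) * f₂
      - ν * coeff v₂ m * e₁ + ν * coeff v₁ m * e₂
  have hnorm : ∀ j : ℕ, ‖W j‖ = ‖W 0‖ := by
    intro j
    induction j with
    | zero => simp
    | succ j ih => rw [Nat.cast_succ, hstep, norm_neg, ih]
  obtain ⟨D, hD⟩ := h₁.exists_norm_coeff_snd_mul_le hv₁
  obtain ⟨B, hB⟩ := exists_norm_coeff_le h₂.continuous_snd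
  have hbound : ∀ j : ℕ, 0 ≤ β + j - a → (β + j - a) * ‖W 0‖ ≤ 2 * D * B := by
    intro j hj
    have hB0 : 0 ≤ B := (norm_nonneg _).trans (hB 0)
    have hd0 := hD j
    have hd1 := hD (j + 1)
    have e1 : β + ((j : ℤ) + 1 : ℤ) = β + (j : ℤ) + 1 := by push_cast; ring
    rw [e1] at hd1
    simp only [Int.cast_natCast] at hd0 hd1
    rw [abs_of_nonneg hj] at hd0
    rw [abs_of_nonneg (by linarith)] at hd1
    have hd2 : (β + j - a) * ‖coeff v₁ (β + j + 1)‖ ≤ D :=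
      (mul_le_mul_of_nonneg_right (by linarith) (norm_nonneg _)).trans hd1
    have hWj : ‖W j‖ ≤ ‖coeff v₁ (β + j + 1)‖ * B + ‖coeff v₁ (β + j)‖ * B := by
      simp only [hW, Int.cast_natCast]
      refine (norm_sub_le _ _).trans (add_le_add ?_ ?_)
      all_goals
        rw [norm_mul]
        exact mul_le_mul_of_nonneg_left (hB _) (norm_nonneg _)
    rw [← hnorm j]
    calc (β + j - a) * ‖W j‖
        ≤ (β + j - a) * (‖coeff v₁ (β + j + 1)‖ * B + ‖coeff v₁ (β + j)‖ * B) := by gcongr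
      _ = ((β + j - a) * ‖coeff v₁ (β + j + 1)‖ + (β + j - a) * ‖coeff v₁ (β + j)‖) * B := by ring
      _ ≤ (D + D) * B := by gcongr
      _ = 2 * D * B := by ring
  have hW0 : W 0 = 0 := by
    by_contra hne
    have hpos : 0 < ‖W 0‖ := norm_pos_iff.mpr hne
    obtain ⟨j, hj⟩ := exists_nat_gt (max (a - β) ((2 * D * B) / ‖W 0‖ + a - β))
    have hj1 := (le_max_left _ _).trans_lt hj
    have hj2 := (le_max_right _ _).trans_lt hj
    have h3 := hbound j (by linarith)
    rw [← le_div_iff₀ hpos] at h3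
    linarith
  simpa [hW] using hW0

/-- For a non-integer Floquet exponent, some non-trivial combination of two solutions has no
non-zero Fourier coefficients. -/
theorem exists_coeff_eq_zero (hs : s ≠ 0) (h₁ : IsLinearSolution ν a s u₁ v₁)
    (h₂ : IsLinearSolution ν a s u₂ v₂)
    (hu₁ : u₁ (2 * π) = Complex.exp (2 * π * β * Complex.I) * u₁ 0)
    (hv₁ : v₁ (2 * π) = Complex.exp (2 * π * β * Complex.I) * v₁ 0)
    (hu₂ : u₂ (2 * π) = Complex.exp (2 * π * β * Complex.I) * u₂ 0)
    (hv₂ : v₂ (2 * π) = Complex.exp (2 * π * β * Complex.I) * v₂ 0)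
    (hβ : ∀ j : ℤ, β + j ≠ 0) :
    ∃ c d : ℂ, (c ≠ 0 ∨ d ≠ 0) ∧ ∀ j : ℤ, coeff (fun t => c * u₁ t + d * u₂ t) (β + j) = 0 ∧
      coeff (fun t => c * v₁ t + d * v₂ t) (β + j) = 0 := by
  obtain ⟨c, d, hcd, h0, h1⟩ :=
    exists_ne_zero_of_det_eq_zero (h₁.casoratian_eq_zero hs h₂ hu₁ hv₁ hu₂ hv₂ hβ)
  refine ⟨c, d, hcd, (h₁.linearCombination h₂ c d).coeff_eq_zero_of_consecutive hs ?_ ?_ hβ ?_ ?_⟩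
  · rw [hu₁, hu₂]; ring
  · rw [hv₁, hv₂]; ring
  · rw [coeff_linearCombination h₁.continuous_snd h₂.continuous_snd, h0]
  · rw [coeff_linearCombination h₁.continuous_snd h₂.continuous_snd, h1]

/-- If two solutions are `2π`-periodic, some non-trivial combination of them has no Fourier
coefficients of negative index. -/
theorem exists_coeff_neg_eq_zero (hν : ν ≠ 0) (hs : s ≠ 0) (h₁ : IsLinearSolution ν a s u₁ v₁)
    (h₂ : IsLinearSolution ν a s u₂ v₂) (hu₁ : u₁ (2 * π) = u₁ 0) (hv₁ : v₁ (2 * π) = v₁ 0)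
    (hu₂ : u₂ (2 * π) = u₂ 0) (hv₂ : v₂ (2 * π) = v₂ 0) :
    ∃ c d : ℂ, (c ≠ 0 ∨ d ≠ 0) ∧ ∀ j : ℤ, j < 0 → coeff (fun t => c * u₁ t + d * u₂ t) j = 0 ∧
      coeff (fun t => c * v₁ t + d * v₂ t) j = 0 := by
  have hsC : (s : ℂ) ≠ 0 := by exact_mod_cast hs
  have hνC : (ν : ℂ) ≠ 0 := by exact_mod_cast hν
  obtain ⟨c, d, hcd, h0, -⟩ := exists_ne_zero_of_det_eq_zero (p := coeff v₁ (-1))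
    (q := coeff v₂ (-1)) (p' := 0) (q' := 0) (by simp)
  refine ⟨c, d, hcd, ?_⟩
  have h := h₁.linearCombination h₂ c d
  rw [← coeff_linearCombination h₁.continuous_snd h₂.continuous_snd] at h0
  have hu : (fun t => c * u₁ t + d * u₂ t) (2 * π) = (fun t => c * u₁ t + d * u₂ t) 0 := by
    simp only [hu₁, hu₂]
  have hv : (fun t => c * v₁ t + d * v₂ t) (2 * π) = (fun t => c * v₁ t + d * v₂ t) 0 := by
    simp only [hv₁, hv₂]
  set u := fun t => c * u₁ t + d * u₂ t
  set v := fun t => c * v₁ t + d * v₂ t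
  have hexp : ∀ j : ℤ, Complex.exp (2 * π * ((j : ℝ) : ℂ) * Complex.I) = 1 := by
    intro j
    have := exp_two_pi_mul_add_int 0 j
    simpa using this
  have hrec1 := fun j : ℤ => h.coeff_fst_eq (m := j) (by rw [hexp, one_mul]; exact hu)
  have hrec2 := fun j : ℤ => h.coeff_snd_eq (m := j) (by rw [hexp, one_mul]; exact hv)
  have hV0 : coeff v 0 = 0 := by
    have := hrec1 0
    simpa [hνC] using this
  have hU : ∀ j : ℤ, j ≠ 0 → coeff v j = 0 → coeff u j = 0 := by
    intro j hj hvj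
    have := hrec1 j
    simpa [hvj, hj, Complex.I_ne_zero] using this
  have hV : ∀ i : ℕ, coeff v (-(i : ℝ)) = 0 ∧ coeff v (-(i : ℝ) - 1) = 0 := by
    intro i
    induction i with
    | zero => simpa using ⟨hV0, h0⟩
    | succ i ih =>
      have h2 := hrec2 (-i - 1)
      have h3 := hU (-i - 1) (by omega)
      push_cast at h2 h3 ⊢
      rw [h3 ih.2, ih.2, sub_add_cancel, ih.1] at h2
      rw [neg_add, ← sub_eq_add_neg]
      refine ⟨ih.2, ?_⟩
      simpa [hsC] using h2
  intro j hj
  obtain ⟨i, rfl⟩ : ∃ i : ℕ, j = -i := ⟨j.natAbs, by omega⟩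
  have hi : coeff v ((-(i : ℤ) : ℤ) : ℝ) = 0 := by simpa using (hV i).1
  exact ⟨hU _ hj.ne hi, hi⟩

end IsLinearSolution

/-- If `f` dominates `q` and the phase of `f - q` has total increment `2πγ`, then `f` has a non-zero
Fourier coefficient at a frequency `γ - l` with `l` a natural number. -/
theorem exists_coeff_ne_zero {f q : ℝ → ℂ} {ρ φ : ℝ → ℝ} {D : ℂ} {γ : ℝ} (hf : Continuous f)
    (hφ : Continuous φ) (hq : ∀ t, ‖q t‖ ≤ ‖f t‖) (hρ : ∀ t, 0 < ρ t) (hD : D ≠ 0)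
    (hper : φ (2 * π) = φ 0 + 2 * π * γ)
    (h : ∀ t, f t - q t = D / ρ t * Complex.exp (φ t * Complex.I)) :
    ∃ l : ℕ, coeff f (γ - l) ≠ 0 := by
  have hpos : ∀ t : ℝ, 0 < ((starRingEnd ℂ) D * (f t * Complex.exp (-(γ * t * Complex.I)))
      * Complex.exp (-(((φ t - γ * t : ℝ) : ℂ) * Complex.I))).re := by
    intro t
    have hρC : (ρ t : ℂ) ≠ 0 := by exact_mod_cast (hρ t).ne'
    have hconj : (starRingEnd ℂ) (f t - q t)
        = (starRingEnd ℂ) D / ρ t * Complex.exp (-(φ t * Complex.I)) := by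
      rw [h t, map_mul, map_div₀, Complex.conj_ofReal, ← Complex.exp_conj, map_mul,
        Complex.conj_ofReal, Complex.conj_I, mul_neg]
    have key : (starRingEnd ℂ) D * (f t * Complex.exp (-(γ * t * Complex.I)))
        * Complex.exp (-(((φ t - γ * t : ℝ) : ℂ) * Complex.I))
        = ρ t * (f t * (starRingEnd ℂ) (f t - q t)) := by
      rw [hconj, mul_assoc, mul_assoc, ← Complex.exp_add]
      have : -((γ : ℂ) * t * Complex.I) + -(((φ t - γ * t : ℝ) : ℂ) * Complex.I)
          = -(φ t * Complex.I) := by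
        push_cast
        ring
      rw [this]
      field_simp
    rw [key, Complex.re_ofReal_mul]
    refine mul_pos (hρ t) ?_
    have hne : f t - q t ≠ 0 := by
      rw [h t]
      exact mul_ne_zero (div_ne_zero hD hρC) (Complex.exp_ne_zero _)
    have h1 := Complex.normSq_pos.mpr hne
    have h2 : Complex.normSq (q t) ≤ Complex.normSq (f t) := by
      rw [Complex.normSq_eq_norm_sq, Complex.normSq_eq_norm_sq]
      exact pow_le_pow_left₀ (norm_nonneg _) (hq t) 2
    simp only [Complex.normSq_apply, Complex.sub_re, Complex.sub_im] at h1 h2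
    simp only [Complex.mul_re, Complex.conj_re, Complex.conj_im, Complex.sub_re, Complex.sub_im]
    nlinarith
  obtain ⟨l, hl⟩ := exists_integral_mul_exp_pow_ne_zero
    (w := fun t => (starRingEnd ℂ) D * (f t * Complex.exp (-(γ * t * Complex.I))))
    (θ := fun t => φ t - γ * t) (by fun_prop) (by fun_prop) (by rw [hper]; ring) hpos
  refine ⟨l, fun h0 => hl ?_⟩
  have : ∀ t : ℝ, (starRingEnd ℂ) D * (f t * Complex.exp (-(γ * t * Complex.I)))
      * Complex.exp (t * Complex.I) ^ l
      = (starRingEnd ℂ) D * (f t * Complex.exp (-(((γ - l : ℝ) : ℂ) * t * Complex.I))) := by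
    intro t
    rw [← Complex.exp_nat_mul, mul_assoc, mul_assoc, ← Complex.exp_add]
    congr 3
    push_cast
    ring
  simp only [this]
  rw [intervalIntegral.integral_const_mul]
  unfold coeff at h0
  rw [h0, mul_zero]

/-- The modulus of the linear lift of a solution of the class-D equation. -/
noncomputable def amplitude (ν : ℝ) (x : ℝ → ℝ) (t : ℝ) : ℝ :=
  Real.exp (-(ν / 2) * ∫ τ in (0 : ℝ)..t, Real.cos (x τ))

/-- The first component of the linear lift of a solution of the class-D equation. -/
noncomputable def liftFst (ν a s : ℝ) (x : ℝ → ℝ) (t : ℝ) : ℂ :=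
  amplitude ν x t * Complex.exp (((a * t - s * Real.cos t - x t) / 2 : ℝ) * Complex.I)

/-- The second component of the linear lift of a solution of the class-D equation. -/
noncomputable def liftSnd (ν a s : ℝ) (x : ℝ → ℝ) (t : ℝ) : ℂ :=
  amplitude ν x t * Complex.exp (((a * t - s * Real.cos t + x t) / 2 : ℝ) * Complex.I)

theorem amplitude_pos (ν : ℝ) (x : ℝ → ℝ) (t : ℝ) : 0 < amplitude ν x t := Real.exp_pos _

@[simp]
theorem amplitude_zero (ν : ℝ) (x : ℝ → ℝ) : amplitude ν x 0 = 1 := by simp [amplitude]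

theorem exp_mul_liftFst (ν a s : ℝ) (x : ℝ → ℝ) (t : ℝ) :
    Complex.exp (x t * Complex.I) * liftFst ν a s x t = liftSnd ν a s x t := by
  unfold liftFst liftSnd
  rw [mul_left_comm, ← Complex.exp_add]
  congr 2
  push_cast
  ring

theorem exp_neg_mul_liftSnd (ν a s : ℝ) (x : ℝ → ℝ) (t : ℝ) :
    Complex.exp (-(x t * Complex.I)) * liftSnd ν a s x t = liftFst ν a s x t := by
  rw [← exp_mul_liftFst, ← mul_assoc, ← Complex.exp_add, neg_add_cancel, Complex.exp_zero, one_mul]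

theorem two_mul_sin_mul_I (z : ℂ) :
    2 * Complex.sin z * Complex.I = Complex.exp (z * Complex.I) - Complex.exp (-(z * Complex.I)) := by
  rw [Complex.sin, neg_mul]
  linear_combination (Complex.exp (-(z * Complex.I)) - Complex.exp (z * Complex.I)) * Complex.I_mul_I

namespace IsClassDSolution

variable {ν a s : ℝ} {r : ℤ} {x x₁ x₂ : ℝ → ℝ}

theorem continuous (hx : IsClassDSolution ν a s x) : Continuous x :=
  continuous_iff_continuousAt.mpr fun t => (hx t).continuousAt

theorem hasDerivAt_amplitude (hx : IsClassDSolution ν a s x) (t : ℝ) :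
    HasDerivAt (amplitude ν x) (-(ν / 2) * Real.cos (x t) * amplitude ν x t) t := by
  have hc : Continuous fun τ => Real.cos (x τ) := Real.continuous_cos.comp hx.continuous
  refine (((hc.integral_hasStrictDerivAt 0 t).hasDerivAt).const_mul (-(ν / 2))).exp.congr_deriv ?_
  unfold amplitude
  ring

theorem isLinearSolution (hx : IsClassDSolution ν a s x) :
    IsLinearSolution ν a s (liftFst ν a s x) (liftSnd ν a s x) := by
  have hphase : ∀ t : ℝ, HasDerivAt (fun t => a * t - s * Real.cos t) (a + s * Real.sin t) t := by
    intro t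
    refine (((hasDerivAt_id t).const_mul a).sub
      ((Real.hasDerivAt_cos t).const_mul s)).congr_deriv ?_
    ring
  have hρ := fun t => (hx.hasDerivAt_amplitude t).ofReal_comp
  constructor
  · intro t
    have h1 := ((((hphase t).sub (hx t)).div_const 2).ofReal_comp.mul_const Complex.I).cexp
    refine ((hρ t).mul h1).congr_deriv ?_
    rw [← exp_mul_liftFst, Complex.exp_mul_I (x t), liftFst]
    simp only [Pi.sub_apply]
    push_cast
    ring
  · intro t
    have h1 := ((((hphase t).add (hx t)).div_const 2).ofReal_comp.mul_const Complex.I).cexp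
    refine ((hρ t).mul h1).congr_deriv ?_
    rw [← exp_neg_mul_liftSnd, ← neg_mul, Complex.exp_mul_I (-x t : ℂ), Complex.cos_neg,
      Complex.sin_neg, liftSnd]
    simp only [Pi.add_apply]
    push_cast
    ring

/-- The Wronskian of the linear lifts of two solutions is constant up to an explicit phase. -/
theorem amplitude_mul_amplitude_mul_sin (h₁ : IsClassDSolution ν a s x₁)
    (h₂ : IsClassDSolution ν a s x₂) (t : ℝ) :
    amplitude ν x₁ t * amplitude ν x₂ t * Real.sin ((x₁ t - x₂ t) / 2)
      = Real.sin ((x₁ 0 - x₂ 0) / 2) := by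
  have hd : ∀ t, HasDerivAt
      (fun t => amplitude ν x₁ t * amplitude ν x₂ t * Real.sin ((x₁ t - x₂ t) / 2)) 0 t := by
    intro t
    refine (((h₁.hasDerivAt_amplitude t).mul (h₂.hasDerivAt_amplitude t)).mul
      (((h₁ t).sub (h₂ t)).div_const 2).sin).congr_deriv ?_
    simp only [Pi.sub_apply, Pi.mul_apply]
    obtain ⟨p, hp⟩ : ∃ p, p = (x₁ t + x₂ t) / 2 := ⟨_, rfl⟩
    obtain ⟨q, hq⟩ : ∃ q, q = (x₁ t - x₂ t) / 2 := ⟨_, rfl⟩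
    rw [← hq, show x₁ t = p + q by rw [hp, hq]; ring, show x₂ t = p - q by rw [hp, hq]; ring,
      Real.cos_add, Real.cos_sub, Real.sin_add, Real.sin_sub]
    ring
  have := is_const_of_deriv_eq_zero (fun t => (hd t).differentiableAt) (fun t => (hd t).deriv) t 0
  simpa using this

theorem amplitude_two_pi_mul (h₁ : IsClassDSolution ν a s x₁) (h₂ : IsClassDSolution ν a s x₂)
    (hr₁ : x₁ (2 * π) = x₁ 0 + 2 * π * r) (hr₂ : x₂ (2 * π) = x₂ 0 + 2 * π * r)
    (hsin : Real.sin ((x₁ 0 - x₂ 0) / 2) ≠ 0) :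
    amplitude ν x₁ (2 * π) * amplitude ν x₂ (2 * π) = 1 := by
  have h := h₁.amplitude_mul_amplitude_mul_sin h₂ (2 * π)
  rw [hr₁, hr₂, add_sub_add_right_eq_sub] at h
  exact mul_right_cancel₀ hsin (by rw [h, one_mul])

/-- At a constriction the linear lift of every solution has modulus one after a period. -/
theorem amplitude_two_pi (hx : IsClassDSolution ν a s x)
    (hconstr : ∀ x : ℝ → ℝ, IsClassDSolution ν a s x → x (2 * π) = x 0 + 2 * π * (r : ℝ)) :
    amplitude ν x (2 * π) = 1 := by
  obtain ⟨y, hy, hy0⟩ := exists_isClassDSolution ν a s (x 0 - 1)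
  obtain ⟨z, hz, hz0⟩ := exists_isClassDSolution ν a s (x 0 - 2)
  have hpi := Real.pi_gt_three
  have hsin : ∀ d : ℝ, 0 < d → d ≤ 2 → Real.sin (d / 2) ≠ 0 := fun d hd hd' =>
    (Real.sin_pos_of_pos_of_lt_pi (by linarith) (by linarith)).ne'
  have hxy := hx.amplitude_two_pi_mul hy (hconstr x hx) (hconstr y hy)
    (by rw [hy0, show x 0 - (x 0 - 1) = 1 by ring]; exact hsin 1 (by norm_num) (by norm_num))
  have hxz := hx.amplitude_two_pi_mul hz (hconstr x hx) (hconstr z hz)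
    (by rw [hz0, show x 0 - (x 0 - 2) = 2 by ring]; exact hsin 2 (by norm_num) (by norm_num))
  have hyz := hy.amplitude_two_pi_mul hz (hconstr y hy) (hconstr z hz)
    (by
      rw [hy0, hz0, show x 0 - 1 - (x 0 - 2) = 1 by ring]
      exact hsin 1 (by norm_num) (by norm_num))
  have hsq : amplitude ν x (2 * π) ^ 2 = 1 := by
    linear_combination amplitude ν x (2 * π) * amplitude ν z (2 * π) * hxy + hxz
      - amplitude ν x (2 * π) ^ 2 * hyz
  exact (pow_eq_one_iff_of_nonneg (amplitude_pos ν x _).le two_ne_zero).mp hsq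

theorem liftFst_two_pi (hx : IsClassDSolution ν a s x)
    (hconstr : ∀ x : ℝ → ℝ, IsClassDSolution ν a s x → x (2 * π) = x 0 + 2 * π * (r : ℝ)) :
    liftFst ν a s x (2 * π)
      = Complex.exp (2 * π * ((a - r) / 2 : ℝ) * Complex.I) * liftFst ν a s x 0 := by
  unfold liftFst
  rw [hx.amplitude_two_pi hconstr, hconstr x hx, amplitude_zero, Complex.ofReal_one, one_mul,
    one_mul, ← Complex.exp_add, Real.cos_two_pi, Real.cos_zero]
  congr 1
  push_cast
  ring

theorem liftSnd_two_pi (hx : IsClassDSolution ν a s x)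
    (hconstr : ∀ x : ℝ → ℝ, IsClassDSolution ν a s x → x (2 * π) = x 0 + 2 * π * (r : ℝ)) :
    liftSnd ν a s x (2 * π)
      = Complex.exp (2 * π * ((a - r) / 2 : ℝ) * Complex.I) * liftSnd ν a s x 0 := by
  rw [← exp_two_pi_mul_add_int _ r]
  unfold liftSnd
  rw [hx.amplitude_two_pi hconstr, hconstr x hx, amplitude_zero, Complex.ofReal_one, one_mul,
    one_mul, ← Complex.exp_add, Real.cos_two_pi, Real.cos_zero]
  congr 1
  push_cast
  ring

theorem liftSnd_sub_exp_mul_liftFst (h₁ : IsClassDSolution ν a s x₁)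
    (h₂ : IsClassDSolution ν a s x₂) (t : ℝ) :
    liftSnd ν a s x₁ t - Complex.exp (x₂ t * Complex.I) * liftFst ν a s x₁ t
      = 2 * Real.sin ((x₁ 0 - x₂ 0) / 2) * Complex.I / amplitude ν x₂ t
        * Complex.exp (((a * t - s * Real.cos t + x₂ t) / 2 : ℝ) * Complex.I) := by
  have hρ : (amplitude ν x₂ t : ℂ) ≠ 0 := by exact_mod_cast (amplitude_pos ν x₂ t).ne'
  rw [← h₁.amplitude_mul_amplitude_mul_sin h₂ t, liftFst, liftSnd]
  have e1 : Complex.exp (((a * t - s * Real.cos t + x₁ t) / 2 : ℝ) * Complex.I)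
      = Complex.exp (((x₁ t - x₂ t) / 2 : ℝ) * Complex.I)
        * Complex.exp (((a * t - s * Real.cos t + x₂ t) / 2 : ℝ) * Complex.I) := by
    rw [← Complex.exp_add]
    congr 1
    push_cast
    ring
  have e2 : Complex.exp (x₂ t * Complex.I)
        * Complex.exp (((a * t - s * Real.cos t - x₁ t) / 2 : ℝ) * Complex.I)
      = Complex.exp (-(((x₁ t - x₂ t) / 2 : ℝ) * Complex.I))
        * Complex.exp (((a * t - s * Real.cos t + x₂ t) / 2 : ℝ) * Complex.I) := by
    rw [← Complex.exp_add, ← Complex.exp_add]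
    congr 1
    push_cast
    ring
  have hs2 := two_mul_sin_mul_I ((x₁ t - x₂ t) / 2 : ℝ)
  rw [← Complex.ofReal_sin] at hs2
  rw [mul_left_comm, e1, e2, Complex.ofReal_mul, Complex.ofReal_mul]
  field_simp
  linear_combination (-amplitude ν x₁ t) * hs2

theorem liftFst_sub_exp_neg_mul_liftSnd (h₁ : IsClassDSolution ν a s x₁)
    (h₂ : IsClassDSolution ν a s x₂) (t : ℝ) :
    liftFst ν a s x₁ t - Complex.exp (-(x₂ t * Complex.I)) * liftSnd ν a s x₁ t
      = -(2 * Real.sin ((x₁ 0 - x₂ 0) / 2) * Complex.I) / amplitude ν x₂ t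
        * Complex.exp (((a * t - s * Real.cos t - x₂ t) / 2 : ℝ) * Complex.I) := by
  have h := h₁.liftSnd_sub_exp_mul_liftFst h₂ t
  have e1 : Complex.exp (-(x₂ t * Complex.I)) * Complex.exp (x₂ t * Complex.I) = 1 := by
    rw [← Complex.exp_add, neg_add_cancel, Complex.exp_zero]
  have e2 : Complex.exp (-(x₂ t * Complex.I))
        * Complex.exp (((a * t - s * Real.cos t + x₂ t) / 2 : ℝ) * Complex.I)
      = Complex.exp (((a * t - s * Real.cos t - x₂ t) / 2 : ℝ) * Complex.I) := by
    rw [← Complex.exp_add]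
    congr 1
    push_cast
    ring
  rw [← e2]
  linear_combination (-Complex.exp (-(x₂ t * Complex.I))) * h - liftFst ν a s x₁ t * e1

/-- A combination of two lifts that is not a multiple of the second one has a non-zero Fourier
coefficient in an explicit half-line of frequencies. -/
theorem exists_coeff_ne_zero_of_left (h₁ : IsClassDSolution ν a s x₁)
    (h₂ : IsClassDSolution ν a s x₂) (hr : x₂ (2 * π) = x₂ 0 + 2 * π * r)
    (hsin : Real.sin ((x₁ 0 - x₂ 0) / 2) ≠ 0) {c₁ : ℂ} (hc : c₁ ≠ 0) (c₂ : ℂ) :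
    (∃ l : ℕ, coeff (fun t => c₁ * liftFst ν a s x₁ t + c₂ * liftFst ν a s x₂ t)
      ((a - r) / 2 - l) ≠ 0) ∨
    ∃ l : ℕ, coeff (fun t => c₁ * liftSnd ν a s x₁ t + c₂ * liftSnd ν a s x₂ t)
      ((a + r) / 2 - l) ≠ 0 := by
  have h := h₁.isLinearSolution.linearCombination h₂.isLinearSolution c₁ c₂
  have hxc := h₂.continuous
  have hsinC : (Real.sin ((x₁ 0 - x₂ 0) / 2) : ℂ) ≠ 0 := by exact_mod_cast hsin
  have hnorm : ∀ y : ℝ, ‖Complex.exp (-(y * Complex.I))‖ = 1 := by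
    intro y
    simpa using norm_exp_neg_mul_I y 1
  have hmono : ∀ z w : ℂ, ‖z‖ ≤ ‖w‖ ↔ Complex.normSq z ≤ Complex.normSq w := by
    intro z w
    rw [Complex.normSq_eq_norm_sq, Complex.normSq_eq_norm_sq,
      pow_le_pow_iff_left₀ (norm_nonneg _) (norm_nonneg _) two_ne_zero]
  have hcons := h.normSq_sub_normSq
  rcases le_total (Complex.normSq (c₁ * liftSnd ν a s x₁ 0 + c₂ * liftSnd ν a s x₂ 0))
    (Complex.normSq (c₁ * liftFst ν a s x₁ 0 + c₂ * liftFst ν a s x₂ 0)) with hle | hle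
  · left
    refine exists_coeff_ne_zero (ρ := amplitude ν x₂)
      (φ := fun t => (a * t - s * Real.cos t - x₂ t) / 2)
      (q := fun t => Complex.exp (-(x₂ t * Complex.I))
        * (c₁ * liftSnd ν a s x₁ t + c₂ * liftSnd ν a s x₂ t))
      (D := c₁ * -(2 * Real.sin ((x₁ 0 - x₂ 0) / 2) * Complex.I))
      h.continuous_fst (by fun_prop) ?_ (amplitude_pos ν x₂) ?_ ?_ ?_
    · intro t
      rw [norm_mul, hnorm, one_mul, hmono]
      have := hcons t
      linarith
    · exact mul_ne_zero hc (neg_ne_zero.mpr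
        (mul_ne_zero (mul_ne_zero two_ne_zero hsinC) Complex.I_ne_zero))
    · simp only [hr, Real.cos_two_pi, Real.cos_zero]
      ring
    · intro t
      linear_combination c₁ * h₁.liftFst_sub_exp_neg_mul_liftSnd h₂ t
        - c₂ * exp_neg_mul_liftSnd ν a s x₂ t
  · right
    refine exists_coeff_ne_zero (ρ := amplitude ν x₂)
      (φ := fun t => (a * t - s * Real.cos t + x₂ t) / 2)
      (q := fun t => Complex.exp (x₂ t * Complex.I)
        * (c₁ * liftFst ν a s x₁ t + c₂ * liftFst ν a s x₂ t))
      (D := c₁ * (2 * Real.sin ((x₁ 0 - x₂ 0) / 2) * Complex.I))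
      h.continuous_snd (by fun_prop) ?_ (amplitude_pos ν x₂) ?_ ?_ ?_
    · intro t
      rw [norm_mul, Complex.norm_exp_ofReal_mul_I, one_mul, hmono]
      have := hcons t
      linarith
    · exact mul_ne_zero hc (mul_ne_zero (mul_ne_zero two_ne_zero hsinC) Complex.I_ne_zero)
    · simp only [hr, Real.cos_two_pi, Real.cos_zero]
      ring
    · intro t
      linear_combination c₁ * h₁.liftSnd_sub_exp_mul_liftFst h₂ t
        - c₂ * exp_mul_liftFst ν a s x₂ t

/-- A non-trivial combination of the lifts of two distinct solutions has a non-zero Fourier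
coefficient in an explicit half-line of frequencies. -/
theorem exists_coeff_linearCombination_ne_zero (h₁ : IsClassDSolution ν a s x₁)
    (h₂ : IsClassDSolution ν a s x₂) (hr₁ : x₁ (2 * π) = x₁ 0 + 2 * π * r)
    (hr₂ : x₂ (2 * π) = x₂ 0 + 2 * π * r)
    (hsin : Real.sin ((x₁ 0 - x₂ 0) / 2) ≠ 0) {c₁ c₂ : ℂ} (hc : c₁ ≠ 0 ∨ c₂ ≠ 0) :
    (∃ l : ℕ, coeff (fun t => c₁ * liftFst ν a s x₁ t + c₂ * liftFst ν a s x₂ t)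
      ((a - r) / 2 - l) ≠ 0) ∨
    ∃ l : ℕ, coeff (fun t => c₁ * liftSnd ν a s x₁ t + c₂ * liftSnd ν a s x₂ t)
      ((a + r) / 2 - l) ≠ 0 := by
  rcases hc with hc | hc
  · exact h₁.exists_coeff_ne_zero_of_left h₂ hr₂ hsin hc c₂
  · have hsin' : Real.sin ((x₂ 0 - x₁ 0) / 2) ≠ 0 := by
      rw [← neg_sub, neg_div, Real.sin_neg]
      exact neg_ne_zero.mpr hsin
    simp only [add_comm (c₁ * _)]
    exact h₂.exists_coeff_ne_zero_of_left h₁ hr₁ hsin' hc c₁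

theorem neg (hx : IsClassDSolution ν a s x) :
    IsClassDSolution ν (-a) (-s) fun t => -x t := by
  intro t
  refine (hx t).fun_neg.congr_deriv ?_
  rw [Real.sin_neg]
  ring

end IsClassDSolution

section Constriction

variable {ν a s : ℝ} {r : ℤ}

theorem exists_isClassDSolution_pair (ν a s : ℝ) : ∃ x₁ x₂, IsClassDSolution ν a s x₁ ∧
    IsClassDSolution ν a s x₂ ∧ Real.sin ((x₁ 0 - x₂ 0) / 2) ≠ 0 := by
  obtain ⟨x₁, h₁, h₁0⟩ := exists_isClassDSolution ν a s π
  obtain ⟨x₂, h₂, h₂0⟩ := exists_isClassDSolution ν a s 0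
  exact ⟨x₁, x₂, h₁, h₂, by simp [h₁0, h₂0]⟩

/-- The abscissa of a constriction is an integer of the same parity as the rotation number. -/
theorem exists_abscissa_eq_rotation_add (hs : s ≠ 0)
    (hconstr : ∀ x : ℝ → ℝ, IsClassDSolution ν a s x → x (2 * π) = x 0 + 2 * π * (r : ℝ)) :
    ∃ j : ℤ, a = r + 2 * j := by
  by_contra! hne
  obtain ⟨x₁, x₂, h₁, h₂, hsin⟩ := exists_isClassDSolution_pair ν a s
  obtain ⟨c, d, hcd, hzero⟩ := h₁.isLinearSolution.exists_coeff_eq_zero hs h₂.isLinearSolution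
    (h₁.liftFst_two_pi hconstr) (h₁.liftSnd_two_pi hconstr) (h₂.liftFst_two_pi hconstr)
    (h₂.liftSnd_two_pi hconstr) (fun j hj => hne (-j) (by push_cast; linarith))
  rcases h₁.exists_coeff_linearCombination_ne_zero h₂ (hconstr x₁ h₁) (hconstr x₂ h₂) hsin hcd
    with ⟨l, hl⟩ | ⟨l, hl⟩
  · refine hl ?_
    have := (hzero (-l)).1
    push_cast at this
    rwa [← sub_eq_add_neg] at this
  · refine hl ?_
    have := (hzero (r - l)).2
    push_cast at this
    rwa [show (a - r) / 2 + ((r : ℝ) - l) = (a + r) / 2 - l by ring] at this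

theorem rotation_le_abscissa_of_nonpos (hν : ν ≠ 0) (hs : s ≠ 0) (ha : a ≤ 0)
    (hconstr : ∀ x : ℝ → ℝ, IsClassDSolution ν a s x → x (2 * π) = x 0 + 2 * π * (r : ℝ)) :
    r ≤ a := by
  obtain ⟨j, hj⟩ := exists_abscissa_eq_rotation_add hs hconstr
  have hr : (r : ℝ) ≤ 0 := by exact_mod_cast rotation_nonpos_of_abscissa_nonpos ha hconstr
  by_contra! hlt
  have hj0 : (j : ℝ) < 0 := by linarith
  have hrj0 : (j : ℝ) + r < 0 := by linarith
  obtain ⟨x₁, x₂, h₁, h₂, hsin⟩ := exists_isClassDSolution_pair ν a s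
  have hexp : Complex.exp (2 * π * ((a - r) / 2 : ℝ) * Complex.I) = 1 := by
    have := exp_two_pi_mul_add_int 0 j
    rw [show (a - r) / 2 = 0 + (j : ℝ) by rw [hj]; ring, this]
    simp
  have hmult : ∀ {z w : ℂ}, z = Complex.exp (2 * π * ((a - r) / 2 : ℝ) * Complex.I) * w → z = w :=
    fun h => by rw [h, hexp, one_mul]
  obtain ⟨c, d, hcd, hzero⟩ := h₁.isLinearSolution.exists_coeff_neg_eq_zero hν hs
    h₂.isLinearSolution (hmult (h₁.liftFst_two_pi hconstr)) (hmult (h₁.liftSnd_two_pi hconstr))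
    (hmult (h₂.liftFst_two_pi hconstr)) (hmult (h₂.liftSnd_two_pi hconstr))
  rcases h₁.exists_coeff_linearCombination_ne_zero h₂ (hconstr x₁ h₁) (hconstr x₂ h₂) hsin hcd
    with ⟨l, hl⟩ | ⟨l, hl⟩
  · refine hl ?_
    have hneg : j < 0 := by exact_mod_cast hj0
    have := (hzero (j - l) (by omega)).1
    push_cast at this
    rwa [show (j : ℝ) - l = (a - r) / 2 - l by rw [hj]; ring] at this
  · refine hl ?_
    have hneg : j + r < 0 := by exact_mod_cast hrj0
    have := (hzero (j + r - l) (by omega)).2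
    push_cast at this
    rwa [show (j : ℝ) + r - l = (a + r) / 2 - l by rw [hj]; ring] at this

theorem abscissa_le_rotation_of_nonneg (hν : ν ≠ 0) (hs : s ≠ 0) (ha : 0 ≤ a)
    (hconstr : ∀ x : ℝ → ℝ, IsClassDSolution ν a s x → x (2 * π) = x 0 + 2 * π * (r : ℝ)) :
    a ≤ r := by
  have h := rotation_le_abscissa_of_nonpos (r := -r) hν (neg_ne_zero.mpr hs)
    (neg_nonpos.mpr ha) fun x hx => ?_
  · push_cast at h
    linarith
  · have hy := hx.neg
    rw [neg_neg, neg_neg] at hy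
    have := hconstr _ hy
    push_cast
    linarith

end Constriction

/-- If `ν ≠ 0`, `s ≠ 0` and `(a, s)` is a constriction with rotation number `r`,
then `a` is an integer `k`, the difference `r - k` is even, and if `k ≠ r`
then either `r < k < 0` or `0 < k < r`. -/
theorem constriction_abscissa_parity_and_bounds
    (ν a s : ℝ) (r : ℤ) (hν : ν ≠ 0) (hs : s ≠ 0)
    (hconstr : ∀ x : ℝ → ℝ, IsClassDSolution ν a s x →
      x (2 * π) = x 0 + 2 * π * (r : ℝ)) :
    ∃ k : ℤ, a = (k : ℝ) ∧ Even (r - k) ∧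
      (k ≠ r → (r < k ∧ k < 0) ∨ (0 < k ∧ k < r)) := by
  obtain ⟨j, hj⟩ := exists_abscissa_eq_rotation_add hs hconstr
  obtain ⟨k, hk⟩ : ∃ k : ℤ, k = r + 2 * j := ⟨_, rfl⟩
  have hak : a = k := by rw [hj, hk]; push_cast; ring
  have hneg : k ≤ 0 → r ≤ k := fun h => by
    have := rotation_le_abscissa_of_nonpos hν hs (by rw [hak]; exact_mod_cast h) hconstr
    rw [hak] at this
    exact_mod_cast this
  have hpos : 0 ≤ k → k ≤ r := fun h => by
    have := abscissa_le_rotation_of_nonneg hν hs (by rw [hak]; exact_mod_cast h) hconstr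
    rw [hak] at this
    exact_mod_cast this
  exact ⟨k, hak, ⟨-j, by omega⟩, fun hne => by omega⟩
end

section
/- Let ν, s, a₁, a₂ ∈ ℝ with a₁ < a₂. Let x₁, x₂ : ℝ → ℝ be differentiable with x₁′(t) = ν·sin(x₁(t)) + a₁ + s·sin(t) and x₂′(t) = ν·sin(x₂(t)) + a₂ + s·sin(t) for all t, and suppose x₁(0) = x₂(0). Then x₁(t) < x₂(t) for every t > 0 (the flow of the class-D equation is strictly increasing in the parameter a). -/
open Real

/-- Strict comparison: if `f` and `g` agree at `a` and `f' < g'` wherever `f` and `g` meet, then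
`f < g` to the right of `a`. -/
theorem lt_of_hasDerivAt_lt_of_eq {f g f' g' : ℝ → ℝ} {a : ℝ}
    (hf : ∀ t, HasDerivAt f (f' t) t) (hg : ∀ t, HasDerivAt g (g' t) t) (h0 : f a = g a)
    (h : ∀ t, f t = g t → f' t < g' t) {t : ℝ} (ht : a < t) : f t < g t := by
  have hle : ∀ u, a ≤ u → f u ≤ g u := fun u hu =>
    image_le_of_deriv_right_lt_deriv_boundary
      (fun x _ => (hf x).continuousAt.continuousWithinAt) (fun x _ => (hf x).hasDerivWithinAt)
      h0.le hg (fun x _ => h x) (Set.right_mem_Icc.2 hu)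
  refine (hle t ht.le).lt_of_ne fun heq => ?_
  have hmin : IsLocalMin (g - f) t := by
    filter_upwards [lt_mem_nhds ht] with u hu
    simpa [heq] using hle u hu.le
  have hzero := hmin.hasDerivAt_eq_zero ((hg t).sub (hf t))
  linarith [h t heq]

/-- Monotonicity of the class-D flow in the parameter `a`: if `a₁ < a₂`, `x₁`, `x₂` are
solutions for parameters `a₁`, `a₂` respectively with `x₁(0) = x₂(0)`, then
`x₁(t) < x₂(t)` for all `t > 0`. -/
theorem classD_flow_strict_mono_in_a
    (ν s a₁ a₂ : ℝ) (ha : a₁ < a₂) (x₁ x₂ : ℝ → ℝ)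
    (hx₁ : ∀ t : ℝ, HasDerivAt x₁ (ν * Real.sin (x₁ t) + a₁ + s * Real.sin t) t)
    (hx₂ : ∀ t : ℝ, HasDerivAt x₂ (ν * Real.sin (x₂ t) + a₂ + s * Real.sin t) t)
    (h0 : x₁ 0 = x₂ 0) :
    ∀ t : ℝ, 0 < t → x₁ t < x₂ t := by
  intro t ht
  refine lt_of_hasDerivAt_lt_of_eq hx₁ hx₂ h0 (fun u hu => ?_) ht
  rw [hu]
  linarith
end

section
/- Let ν, a, s ∈ ℝ with ν ≠ 0 and a ≥ 0. Then for every solution x of the class-D equation with parameters (ν, a, s), liminf_{n→∞} (x(2πn) − x(0))/(2πn) ≥ 0; symmetrically, if a ≤ 0 then limsup_{n→∞} (x(2πn) − x(0))/(2πn) ≤ 0 for every solution x. -/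
open Real Filter

theorem IsClassDSolution.neg_comp_add_pi {ν a s : ℝ} {x : ℝ → ℝ}
    (hx : IsClassDSolution ν a s x) : IsClassDSolution ν (-a) s (fun t => -x (t + π)) := by
  intro t
  refine ((hx (t + π)).comp_add_const t π).fun_neg.congr_deriv ?_
  rw [Real.sin_add_pi, Real.sin_neg]
  ring

theorem IsClassDSolution.abs_sub_le {ν a s : ℝ} {x : ℝ → ℝ}
    (hx : IsClassDSolution ν a s x) (t u : ℝ) :
    |x u - x t| ≤ (|ν| + |a| + |s|) * |u - t| := by
  have hbound : ∀ r, ‖ν * Real.sin (x r) + a + s * Real.sin r‖ ≤ |ν| + |a| + |s| := by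
    intro r
    rw [Real.norm_eq_abs]
    refine (abs_add_three _ _ _).trans ?_
    rw [abs_mul, abs_mul]
    have h₁ := mul_le_of_le_one_right (abs_nonneg ν) (Real.abs_sin_le_one (x r))
    have h₂ := mul_le_of_le_one_right (abs_nonneg s) (Real.abs_sin_le_one r)
    linarith
  simpa only [Real.norm_eq_abs] using
    convex_univ.norm_image_sub_le_of_norm_hasDerivWithin_le
      (fun r _ => (hx r).hasDerivWithinAt) (fun r _ => hbound r)
      (Set.mem_univ t) (Set.mem_univ u)

/-- A function that starts nonpositive and satisfies `w' ≤ L |w|` stays nonpositive. -/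
theorem nonpos_of_hasDerivAt_le_mul_abs {w w' : ℝ → ℝ} {L : ℝ}
    (hw : ∀ t, HasDerivAt w (w' t) t) (hle : ∀ t, w' t ≤ L * |w t|) (h0 : w 0 ≤ 0)
    {t : ℝ} (ht : 0 ≤ t) : w t ≤ 0 := by
  have key : ∀ ε > 0, w t ≤ ε * Real.exp ((L + 1) * t) := by
    intro ε hε
    have hB : ∀ r, HasDerivAt (fun r => ε * Real.exp ((L + 1) * r))
        (ε * (Real.exp ((L + 1) * r) * (L + 1))) r := fun r => by
      simpa using (((hasDerivAt_id r).const_mul (L + 1)).exp).const_mul ε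
    refine image_le_of_deriv_right_lt_deriv_boundary (a := 0) (b := t)
      (fun r _ => (hw r).continuousAt.continuousWithinAt)
      (fun r _ => (hw r).hasDerivWithinAt) (by simpa using h0.trans hε.le) hB ?_
      (Set.right_mem_Icc.2 ht)
    intro r _ hr
    have hpos : 0 < ε * Real.exp ((L + 1) * r) := by positivity
    have h := hle r
    rw [hr, abs_of_pos hpos] at h
    linarith
  refine le_of_forall_pos_le_add fun δ hδ => ?_
  have h := key (δ / Real.exp ((L + 1) * t)) (by positivity)
  rwa [div_mul_cancel₀ _ (Real.exp_pos _).ne', ← zero_add δ] at h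

/-- The reflected half-period shift of a solution with `a ≥ 0` is a subsolution, hence stays
below a suitable translate of the solution; so the solution is bounded below. -/
theorem IsClassDSolution.exists_lower_bound {ν a s : ℝ} {x : ℝ → ℝ} (ha : 0 ≤ a)
    (hx : IsClassDSolution ν a s x) : ∃ K, ∀ t, 0 ≤ t → K ≤ x t := by
  obtain ⟨k, hk⟩ := exists_int_ge ((-x π - x 0) / (2 * π))
  rw [div_le_iff₀ (by positivity)] at hk
  have hy := hx.neg_comp_add_pi
  have hw : ∀ t, HasDerivAt (fun t => -x (t + π) - x t - k * (2 * π)) _ t :=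
    fun t => ((hy t).sub (hx t)).sub_const _
  have hle := fun t (ht : 0 ≤ t) => nonpos_of_hasDerivAt_le_mul_abs (L := |ν|) hw
    (fun t => by
      rw [← Real.sin_sub_int_mul_two_pi (-x (t + π)) k]
      have h₁ := abs_mul ν (Real.sin (-x (t + π) - k * (2 * π)) - Real.sin (x t))
      have h₂ := le_abs_self (ν * (Real.sin (-x (t + π) - k * (2 * π)) - Real.sin (x t)))
      have h₃ := mul_le_mul_of_nonneg_left
        (Real.abs_sin_sub_sin_le (-x (t + π) - k * (2 * π)) (x t)) (abs_nonneg ν)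
      rw [show -x (t + π) - k * (2 * π) - x t = -x (t + π) - x t - k * (2 * π) by ring] at h₃
      linarith)
    (by simp only [zero_add]; linarith) ht
  refine ⟨-(k * (2 * π) + (|ν| + |a| + |s|) * π) / 2, fun t ht => ?_⟩
  have h₁ := hle t ht
  have h₂ := (le_abs_self _).trans (hx.abs_sub_le t (t + π))
  rw [add_sub_cancel_left, abs_of_pos Real.pi_pos] at h₂
  linarith

theorem IsClassDSolution.exists_upper_bound {ν a s : ℝ} {x : ℝ → ℝ} (ha : a ≤ 0)
    (hx : IsClassDSolution ν a s x) : ∃ K, ∀ t, 0 ≤ t → x t ≤ K := by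
  obtain ⟨K, hK⟩ := hx.neg_comp_add_pi.exists_lower_bound (neg_nonneg.2 ha)
  refine ⟨-K + (|ν| + |a| + |s|) * π, fun t ht => ?_⟩
  have h₁ := hK t ht
  have h₂ := (neg_abs_le _).trans' (neg_le_neg (hx.abs_sub_le t (t + π)))
  rw [add_sub_cancel_left, abs_of_pos Real.pi_pos] at h₂
  linarith

theorem IsClassDSolution.abs_average_le {ν a s : ℝ} {x : ℝ → ℝ}
    (hx : IsClassDSolution ν a s x) (n : ℕ) :
    |(x (2 * π * n) - x 0) / (2 * π * n)| ≤ |ν| + |a| + |s| := by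
  rw [abs_div]
  refine div_le_of_le_mul₀ (abs_nonneg _) (by positivity) ?_
  simpa using hx.abs_sub_le 0 (2 * π * n)

theorem tendsto_const_div_two_pi_mul_nat (c : ℝ) :
    Tendsto (fun n : ℕ => c / (2 * π * n)) atTop (nhds 0) :=
  (tendsto_natCast_atTop_atTop.const_mul_atTop Real.two_pi_pos).const_div_atTop c

/-- If `a ≥ 0` then for every solution of the class-D equation the lower rotation number
is nonnegative; symmetrically, if `a ≤ 0` then the upper rotation number is nonpositive. -/
theorem classD_rotation_number_sign
    (ν a s : ℝ) (hν : ν ≠ 0) :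
    (0 ≤ a → ∀ x : ℝ → ℝ, IsClassDSolution ν a s x →
      0 ≤ liminf (fun n : ℕ => (x (2 * π * n) - x 0) / (2 * π * n)) atTop) ∧
    (a ≤ 0 → ∀ x : ℝ → ℝ, IsClassDSolution ν a s x →
      limsup (fun n : ℕ => (x (2 * π * n) - x 0) / (2 * π * n)) atTop ≤ 0) := by
  constructor
  · intro ha x hx
    obtain ⟨K, hK⟩ := hx.exists_lower_bound ha
    have hlim := tendsto_const_div_two_pi_mul_nat (K - x 0)
    refine hlim.liminf_eq.ge.trans ?_
    refine liminf_le_liminf (Eventually.of_forall fun n => ?_) hlim.isBoundedUnder_ge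
      (isBoundedUnder_of ⟨|ν| + |a| + |s|, fun n =>
        (le_abs_self _).trans (hx.abs_average_le n)⟩).isCoboundedUnder_ge
    have := hK (2 * π * n) (by positivity)
    gcongr
  · intro ha x hx
    obtain ⟨K, hK⟩ := hx.exists_upper_bound ha
    have hlim := tendsto_const_div_two_pi_mul_nat (K - x 0)
    refine le_trans ?_ hlim.limsup_eq.le
    refine limsup_le_limsup (Eventually.of_forall fun n => ?_)
      (isBoundedUnder_of (r := (· ≥ ·)) ⟨-(|ν| + |a| + |s|), fun n =>
        neg_le_of_abs_le (hx.abs_average_le n)⟩).isCoboundedUnder_le hlim.isBoundedUnder_le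
    have := hK (2 * π * n) (by positivity)
    dsimp only
    gcongr
end

section
/- Let U ⊆ ℂ be open, τ₀ ∈ U, and let α, β, γ : ℂ → ℂ be analytic on U. Let ψ : ℂ → ℂ be analytic on U \ {τ₀} and meromorphic at τ₀ with a pole of order k ≥ 1, and suppose ψ satisfies the Riccati equation ψ′(τ) = α(τ) + β(τ)·ψ(τ) + γ(τ)·ψ(τ)² for all τ ∈ U \ {τ₀}. Let v : ℂ → ℂ be analytic on U \ {τ₀}, not identically zero near τ₀, satisfying the variational equation v′(τ) = (β(τ) + 2·γ(τ)·ψ(τ))·v(τ) for all τ ∈ U \ {τ₀}. Then there exist a neighborhood V of τ₀ and an analytic function w on V with w(τ₀) ≠ 0 such that v(τ) = w(τ)·ψ(τ)² for all τ ∈ V \ {τ₀}; in particular v has a pole of order exactly 2k at τ₀. -/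
open Topology Filter

/-- A punctured ball in a real inner product space of dimension `> 1` is preconnected. -/
theorem isPreconnected_ball_diff_singleton {E : Type*} [NormedAddCommGroup E]
    [InnerProductSpace ℝ E] (h : 1 < Module.rank ℝ E) (c : E) {r : ℝ} (hr : 0 < r) :
    IsPreconnected (Metric.ball c r \ {c}) := by
  let e := OpenPartialHomeomorph.univBall c r
  have hcont : Continuous e := OpenPartialHomeomorph.continuous_univBall c r
  have hinj : Function.Injective e := by
    simpa [e, Set.injOn_univ] using e.injOn
  have himage : e '' Set.univ = Metric.ball c r := by
    simpa [e, OpenPartialHomeomorph.univBall_target c hr] using e.image_source_eq_target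
  have : Metric.ball c r \ {c} = e '' {0}ᶜ := by
    rw [Set.compl_eq_univ_sdiff, Set.image_sdiff hinj, himage, Set.image_singleton,
      OpenPartialHomeomorph.univBall_apply_zero]
  rw [this]
  exact (isConnected_compl_singleton_of_one_lt_rank h 0).isPreconnected.image _ hcont.continuousOn

/-- If `ψ' = a + bψ + cψ²` and `v' = (b + 2cψ)v` at a point where `ψ ≠ 0`, then the logarithmic
derivative of `v / ψ²` is `-b - 2a/ψ`, so multiplying by `exp (-Q)` with `Q' = -b - 2a/ψ` gives
zero derivative. -/
theorem hasDerivAt_variational_div_sq_mul_exp {ψ v Q : ℂ → ℂ} {a b c τ : ℂ} (hψ0 : ψ τ ≠ 0)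
    (hψ : HasDerivAt ψ (a + b * ψ τ + c * ψ τ ^ 2) τ)
    (hv : HasDerivAt v ((b + 2 * c * ψ τ) * v τ) τ)
    (hQ : HasDerivAt Q (-b - 2 * a / ψ τ) τ) :
    HasDerivAt (fun t ↦ v t / ψ t ^ 2 * Complex.exp (-Q t)) 0 τ := by
  refine ((hv.fun_div (hψ.fun_pow 2) (pow_ne_zero 2 hψ0)).fun_mul hQ.fun_neg.cexp).congr_deriv ?_
  field_simp
  push_cast
  ring

/-- A nonzero solution `v` of the variational equation `v' = (β + 2γψ)v` along a
meromorphic solution `ψ` (with a pole of order `k ≥ 1` at `τ₀`) of the Riccati equation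
`ψ' = α + βψ + γψ²` factors near `τ₀` as `v = w·ψ²` with `w` analytic, `w(τ₀) ≠ 0`;
in particular `v` has a pole of order exactly `2k` at `τ₀`. -/
theorem variational_solution_pole_order
    (U : Set ℂ) (hU : IsOpen U) (τ₀ : ℂ) (hτ₀ : τ₀ ∈ U)
    (α β γ ψ v : ℂ → ℂ)
    (hα : AnalyticOnNhd ℂ α U) (hβ : AnalyticOnNhd ℂ β U) (hγ : AnalyticOnNhd ℂ γ U)
    (hψa : AnalyticOnNhd ℂ ψ (U \ {τ₀}))
    (k : ℕ) (hk : 1 ≤ k)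
    -- `ψ` has a pole of order `k` at `τ₀`:
    (g : ℂ → ℂ) (hg : AnalyticAt ℂ g τ₀) (hg0 : g τ₀ ≠ 0)
    (hpole : ∀ᶠ τ in 𝓝[≠] τ₀, ψ τ = g τ / (τ - τ₀) ^ k)
    -- `ψ` solves the Riccati equation off `τ₀`:
    (hψeq : ∀ τ ∈ U \ {τ₀}, HasDerivAt ψ (α τ + β τ * ψ τ + γ τ * ψ τ ^ 2) τ)
    (hva : AnalyticOnNhd ℂ v (U \ {τ₀}))
    -- `v` is not identically zero near `τ₀`:
    (hvne : ¬ ∀ᶠ τ in 𝓝[≠] τ₀, v τ = 0)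
    -- `v` solves the variational equation along `ψ` off `τ₀`:
    (hveq : ∀ τ ∈ U \ {τ₀}, HasDerivAt v ((β τ + 2 * γ τ * ψ τ) * v τ) τ) :
    ∃ V ∈ 𝓝 τ₀, ∃ w : ℂ → ℂ, AnalyticOnNhd ℂ w V ∧ w τ₀ ≠ 0 ∧
      (∀ τ ∈ V \ {τ₀}, v τ = w τ * ψ τ ^ 2) ∧
      ∃ u : ℂ → ℂ, AnalyticAt ℂ u τ₀ ∧ u τ₀ ≠ 0 ∧
        ∀ᶠ τ in 𝓝[≠] τ₀, v τ = u τ / (τ - τ₀) ^ (2 * k) := by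
  have hnear : ∀ᶠ τ in 𝓝 τ₀, τ ∈ U ∧ AnalyticAt ℂ g τ ∧ g τ ≠ 0 ∧
      (τ ≠ τ₀ → ψ τ = g τ / (τ - τ₀) ^ k) :=
    (hU.eventually_mem hτ₀).and <| hg.eventually_analyticAt.and <|
      (hg.continuousAt.eventually_ne hg0).and (eventually_nhdsWithin_iff.mp hpole)
  obtain ⟨r, hr, hball⟩ := Metric.eventually_nhds_iff_ball.mp hnear
  have hψ0 : ∀ τ ∈ Metric.ball τ₀ r \ {τ₀}, ψ τ ≠ 0 := fun τ hτ ↦ by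
    rw [(hball τ hτ.1).2.2.2 hτ.2]
    exact div_ne_zero (hball τ hτ.1).2.2.1 (pow_ne_zero _ (sub_ne_zero.mpr hτ.2))
  have hq : DifferentiableOn ℂ (fun τ ↦ -β τ - 2 * α τ * (τ - τ₀) ^ k / g τ)
      (Metric.ball τ₀ r) := fun τ hτ ↦ by
    obtain ⟨hτU, hgτ, hgτ0, -⟩ := hball τ hτ
    have hβτ := (hβ τ hτU).differentiableAt
    have hατ := (hα τ hτU).differentiableAt
    have hgτ := hgτ.differentiableAt
    exact DifferentiableAt.differentiableWithinAt (by fun_prop (disch := assumption))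
  obtain ⟨Q, hQ⟩ := hq.isExactOn_ball
  have hderiv : ∀ τ ∈ Metric.ball τ₀ r \ {τ₀},
      HasDerivAt (fun t ↦ v t / ψ t ^ 2 * Complex.exp (-Q t)) 0 τ := fun τ hτ ↦ by
    obtain ⟨hτU, -, hgτ0, hψτ⟩ := hball τ hτ.1
    refine hasDerivAt_variational_div_sq_mul_exp (hψ0 τ hτ) (hψeq τ ⟨hτU, hτ.2⟩)
      (hveq τ ⟨hτU, hτ.2⟩) ?_
    exact (hQ τ hτ.1).congr_deriv (by rw [hψτ hτ.2, div_div_eq_mul_div])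
  obtain ⟨c, hc⟩ := (Metric.isOpen_ball.sdiff isClosed_singleton).exists_is_const_of_deriv_eq_zero
    (isPreconnected_ball_diff_singleton (Complex.rank_real_complex ▸ Nat.one_lt_ofNat) τ₀ hr)
    (fun τ hτ ↦ (hderiv τ hτ).differentiableAt.differentiableWithinAt)
    (fun τ hτ ↦ (hderiv τ hτ).deriv)
  have hv : ∀ τ ∈ Metric.ball τ₀ r \ {τ₀}, v τ = c * Complex.exp (Q τ) * ψ τ ^ 2 :=
    fun τ hτ ↦ by
      have := hψ0 τ hτ
      rw [← hc τ hτ, Complex.exp_neg]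
      field_simp
  have hmem : Metric.ball τ₀ r \ {τ₀} ∈ 𝓝[≠] τ₀ :=
    sdiff_mem_nhdsWithin_compl (Metric.ball_mem_nhds τ₀ hr) _
  have hc0 : c ≠ 0 := by
    rintro rfl
    exact hvne (by filter_upwards [hmem] with τ hτ; simp [hv τ hτ])
  have hw : AnalyticOnNhd ℂ (fun τ ↦ c * Complex.exp (Q τ)) (Metric.ball τ₀ r) :=
    DifferentiableOn.analyticOnNhd (fun τ hτ ↦
      ((hQ τ hτ).cexp.const_mul c).differentiableAt.differentiableWithinAt) Metric.isOpen_ball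
  have hw0 : c * Complex.exp (Q τ₀) ≠ 0 := mul_ne_zero hc0 (Complex.exp_ne_zero _)
  refine ⟨_, Metric.ball_mem_nhds τ₀ hr, _, hw, hw0, hv, _,
    (hw τ₀ (Metric.mem_ball_self hr)).fun_mul (hg.fun_pow 2),
    mul_ne_zero hw0 (pow_ne_zero 2 hg0), ?_⟩
  filter_upwards [hmem] with τ hτ
  rw [hv τ hτ, (hball τ hτ.1).2.2.2 hτ.2, div_pow, ← pow_mul, mul_comm k 2, mul_div_assoc]
end

section
/- Let φ : ℂ → ℂ be meromorphic on all of ℂ such that φ(z) ≠ 1 at every point z where φ is analytic, φ is analytic at 0 with φ(0) = 0, φ is analytic at every point of the unit circle, and |φ(z)| ≤ 1 for all z with |z| = 1. Then φ has no poles in the open unit disk and |φ(z)| ≤ 1 for all z with |z| ≤ 1. -/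
open Topology Filter

/-- A point where `‖φ‖` tends to infinity is not a point of analyticity. -/
lemma not_analyticAt_of_tendsto_norm_atTop {φ : ℂ → ℂ} {p : ℂ}
    (hp : Tendsto (fun z => ‖φ z‖) (𝓝[≠] p) atTop) : ¬ AnalyticAt ℂ φ p := fun h =>
  not_tendsto_nhds_of_tendsto_atTop hp _
    (h.continuousAt.norm.tendsto.mono_left nhdsWithin_le_nhds)

/-- The map `w ↦ (1 - w)⁻¹` identifies the closed unit disk minus `1` with the half-plane
`1 / 2 ≤ re`. -/
lemma half_le_re_inv_one_sub_iff {w : ℂ} (hw : w ≠ 1) :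
    1 / 2 ≤ ((1 - w)⁻¹).re ↔ ‖w‖ ≤ 1 := by
  have hpos : 0 < Complex.normSq (1 - w) := Complex.normSq_pos.mpr (sub_ne_zero.mpr hw.symm)
  rw [Complex.inv_re, le_div_iff₀ hpos, ← sq_le_one_iff₀ (norm_nonneg w),
    ← Complex.normSq_eq_norm_sq,
    Complex.normSq_apply, Complex.normSq_apply]
  simp only [Complex.sub_re, Complex.sub_im, Complex.one_re, Complex.one_im]
  constructor <;> intro h <;> nlinarith

/-- A lower bound for the real part of an entire function on the unit circle holds on the
closed unit disk. -/
lemma le_re_of_forall_norm_eq_one {g : ℂ → ℂ} (hg : Differentiable ℂ g) {c : ℝ}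
    (hc : ∀ z : ℂ, ‖z‖ = 1 → c ≤ (g z).re) {z : ℂ} (hz : ‖z‖ ≤ 1) : c ≤ (g z).re := by
  have hd : Differentiable ℂ fun z => Complex.exp (-g z) := hg.neg.cexp
  have key : ‖Complex.exp (-g z)‖ ≤ Real.exp (-c) := by
    refine Complex.norm_le_of_forall_mem_frontier_norm_le (U := Metric.ball (0 : ℂ) 1)
      Metric.isBounded_ball hd.diffContOnCl (fun w hw => ?_) ?_
    · rw [frontier_ball _ one_ne_zero, mem_sphere_zero_iff_norm] at hw
      simpa [Complex.norm_exp] using hc w hw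
    · rwa [closure_ball _ one_ne_zero, mem_closedBall_zero_iff]
  simpa [Complex.norm_exp] using key

open Classical in
/-- If `φ` is analytic off a set `P` of isolated poles and omits the value `1`, then
`(1 - φ)⁻¹`, extended by `0` to `P`, is entire. -/
lemma differentiable_ite_inv_one_sub {φ : ℂ → ℂ} {P : Set ℂ}
    (hPiso : ∀ p ∈ P, ∃ V ∈ 𝓝 p, ∀ q ∈ V, q ≠ p → q ∉ P)
    (hφ : AnalyticOnNhd ℂ φ Pᶜ)
    (hP : ∀ p ∈ P, Tendsto (fun z => ‖φ z‖) (𝓝[≠] p) atTop)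
    (hne1 : ∀ z : ℂ, AnalyticAt ℂ φ z → φ z ≠ 1) :
    Differentiable ℂ fun z => if z ∈ P then 0 else (1 - φ z)⁻¹ := by
  have hoff : ∀ z ∉ P, DifferentiableAt ℂ (fun z => if z ∈ P then 0 else (1 - φ z)⁻¹) z := by
    intro z hz
    have hd : DifferentiableAt ℂ (fun z => (1 - φ z)⁻¹) z :=
      ((hφ z hz).differentiableAt.const_sub 1).fun_inv (sub_ne_zero.mpr (hne1 z (hφ z hz)).symm)
    refine hd.congr_of_eventuallyEq ?_
    filter_upwards [(hφ z hz).eventually_analyticAt] with w hw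
    exact if_neg fun hwP => not_analyticAt_of_tendsto_norm_atTop (hP w hwP) hw
  intro p
  by_cases hp : p ∈ P
  · obtain ⟨V, hV, hVP⟩ := hPiso p hp
    have hpunct : ∀ᶠ z in 𝓝[≠] p, z ∉ P := by
      filter_upwards [mem_nhdsWithin_of_mem_nhds hV, self_mem_nhdsWithin] with z hz hzp
      exact hVP z hz hzp
    refine (Complex.analyticAt_of_differentiable_on_punctured_nhds_of_continuousAt
      (hpunct.mono hoff) ?_).differentiableAt
    rw [continuousAt_iff_punctured_nhds, if_pos hp]
    have hlim : Tendsto (fun z => (1 - φ z)⁻¹) (𝓝[≠] p) (𝓝 0) := by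
      refine tendsto_inv₀_cobounded.comp ?_
      rw [← tendsto_norm_atTop_iff_cobounded]
      refine tendsto_atTop_mono (fun z => ?_) (tendsto_atTop_add_const_right _ (-1) (hP p hp))
      have := norm_sub_norm_le (φ z) 1
      rw [norm_one, norm_sub_rev] at this
      linarith
    refine hlim.congr' ?_
    filter_upwards [hpunct] with z hz
    exact (if_neg hz).symm
  · exact hoff p hp

/-- Maximum-modulus / argument-principle statement: let `φ` be meromorphic on `ℂ`
(analytic off a set `P` of isolated points, with `‖φ‖ → ∞` at each point of `P`),
with `φ ≠ 1` wherever `φ` is analytic, `φ` analytic at `0` with `φ(0) = 0`,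
`φ` analytic at every point of the unit circle and `|φ| ≤ 1` there. Then `φ` has
no poles in the open unit disk and `|φ| ≤ 1` on the closed unit disk. -/
theorem meromorphic_max_modulus_no_poles
    (φ : ℂ → ℂ) (P : Set ℂ)
    -- the poles are isolated:
    (hPiso : ∀ p ∈ P, ∃ V ∈ 𝓝 p, ∀ q ∈ V, q ≠ p → q ∉ P)
    -- `φ` is analytic off `P`:
    (hφ : AnalyticOnNhd ℂ φ Pᶜ)
    -- each point of `P` is a pole of `φ`:
    (hP : ∀ p ∈ P, Tendsto (fun z => ‖φ z‖) (𝓝[≠] p) atTop)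
    -- `φ ≠ 1` at every point where `φ` is analytic:
    (hne1 : ∀ z : ℂ, AnalyticAt ℂ φ z → φ z ≠ 1)
    (h0 : AnalyticAt ℂ φ 0) (h00 : φ 0 = 0)
    (hcirc : ∀ z : ℂ, ‖z‖ = 1 → AnalyticAt ℂ φ z)
    (hbd : ∀ z : ℂ, ‖z‖ = 1 → ‖φ z‖ ≤ 1) :
    (∀ z : ℂ, ‖z‖ < 1 → z ∉ P) ∧ (∀ z : ℂ, ‖z‖ ≤ 1 → ‖φ z‖ ≤ 1) := by
  classical
  have hre : ∀ z : ℂ, ‖z‖ ≤ 1 → 1 / 2 ≤ (if z ∈ P then 0 else (1 - φ z)⁻¹ : ℂ).re := by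
    refine fun z => le_re_of_forall_norm_eq_one
      (differentiable_ite_inv_one_sub hPiso hφ hP hne1) fun w hw => ?_
    have hwP : w ∉ P := fun h => not_analyticAt_of_tendsto_norm_atTop (hP w h) (hcirc w hw)
    rw [if_neg hwP]
    exact (half_le_re_inv_one_sub_iff (hne1 w (hcirc w hw))).mpr (hbd w hw)
  have hnotMem : ∀ z : ℂ, ‖z‖ ≤ 1 → z ∉ P := by
    intro z hz hzP
    have h := hre z hz
    rw [if_pos hzP, Complex.zero_re] at h
    norm_num at h
  refine ⟨fun z hz => hnotMem z hz.le, fun z hz => ?_⟩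
  have h := hre z hz
  rw [if_neg (hnotMem z hz)] at h
  exact (half_le_re_inv_one_sub_iff (hne1 z (hφ z (hnotMem z hz)))).mp h
end

section
/- Let h₁₁, h₁₂, h₂₁, h₂₂ : ℂ → ℂ be entire functions such that d(z) := h₁₁(z)·h₂₂(z) − h₁₂(z)·h₂₁(z) ≠ 0 for all z ∈ ℂ, h₁₂(0) = 0, and h₁₁(z) ≠ 0 and h₁₂(z) ≠ 0 for every z with |z| = 1. Let f(z) = d(z)/(h₁₁(z)·h₁₂(z)). Then there exists a natural number n ≥ 1 such that (1/(2πi))·∮_{|z|=1} f′(z)/f(z) dz = −n; that is, the winding number of f along the unit circle is a negative integer. -/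
open Real Complex

open Metric Set Filter Topology

/-- An entire function of finite order of vanishing at `a` is a power of `z - a` times an
entire function that does not vanish at `a`. -/
theorem Differentiable.exists_eq_pow_mul {F : ℂ → ℂ} (hF : Differentiable ℂ F) {a : ℂ}
    (ha : ¬ ∀ᶠ z in 𝓝 a, F z = 0) :
    ∃ (k : ℕ) (G : ℂ → ℂ), Differentiable ℂ G ∧ G a ≠ 0 ∧ ∀ z, F z = (z - a) ^ k * G z := by
  obtain ⟨k, g, hg, hga, hFg⟩ :=
    (hF.analyticAt a).exists_eventuallyEq_pow_smul_nonzero_iff.2 ha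
  have hFa : F a = (a - a) ^ k * g a := hFg.self_of_nhds
  have hquot : ∀ z, z ≠ a → Function.update (fun w => F w / (w - a) ^ k) a (g a) z
      = F z / (z - a) ^ k := fun z hz => Function.update_of_ne hz _ _
  refine ⟨k, Function.update (fun w => F w / (w - a) ^ k) a (g a), fun z => ?_, by simpa, ?_⟩
  · rcases eq_or_ne z a with rfl | hz
    · refine hg.differentiableAt.congr_of_eventuallyEq ?_
      filter_upwards [hFg] with w hw
      rcases eq_or_ne w z with rfl | hwz
      · simp
      · rw [hquot w hwz, hw, smul_eq_mul, mul_div_cancel_left₀]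
        exact pow_ne_zero _ (sub_ne_zero.2 hwz)
    · have hd : DifferentiableAt ℂ (fun w => F w / (w - a) ^ k) z :=
        (hF z).div (by fun_prop) (pow_ne_zero _ (sub_ne_zero.2 hz))
      refine hd.congr_of_eventuallyEq ?_
      filter_upwards [isOpen_ne.mem_nhds hz] with w hw using hquot w hw
  · intro z
    rcases eq_or_ne z a with rfl | hz
    · simpa using hFa
    · rw [hquot z hz, mul_div_cancel₀]
      exact pow_ne_zero _ (sub_ne_zero.2 hz)

/-- The logarithmic derivative of an entire function is differentiable away from its zeros. -/
theorem Differentiable.differentiableAt_logDeriv {F : ℂ → ℂ} (hF : Differentiable ℂ F) {z : ℂ}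
    (hz : F z ≠ 0) : DifferentiableAt ℂ (logDeriv F) z :=
  (hF.analyticAt z).deriv.differentiableAt.div (hF z) hz

theorem Differentiable.circleIntegrable_logDeriv {F : ℂ → ℂ} (hF : Differentiable ℂ F) {c : ℂ}
    {R : ℝ} (hR : 0 ≤ R) (hc : ∀ z ∈ sphere c R, F z ≠ 0) :
    CircleIntegrable (logDeriv F) c R :=
  ContinuousOn.circleIntegrable hR fun z hz =>
    (hF.differentiableAt_logDeriv (hc z hz)).continuousAt.continuousWithinAt

/-- Cauchy's theorem for the logarithmic derivative of a zero-free function. -/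
theorem Differentiable.circleIntegral_logDeriv_eq_zero {F : ℂ → ℂ} (hF : Differentiable ℂ F)
    {c : ℂ} {R : ℝ} (hR : 0 ≤ R) (hc : ∀ z ∈ closedBall c R, F z ≠ 0) :
    (∮ z in C(c, R), logDeriv F z) = 0 :=
  circleIntegral_eq_zero_of_differentiable_on_off_countable hR countable_empty
    (fun z hz => (hF.differentiableAt_logDeriv (hc z hz)).continuousAt.continuousWithinAt)
    fun z hz => hF.differentiableAt_logDeriv (hc z (ball_subset_closedBall hz.1))

/-- Argument principle for an entire function `F` without zeros on a circle: the integral of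
`F' / F` is `2πi n` with `n : ℕ`, and `n` is positive if `F` has a zero inside. -/
theorem Differentiable.exists_circleIntegral_logDeriv_eq {F : ℂ → ℂ} (hF : Differentiable ℂ F)
    {c : ℂ} {R : ℝ} (hR : 0 < R) (hc : ∀ z ∈ sphere c R, F z ≠ 0) :
    ∃ n : ℕ, ((∃ z ∈ ball c R, F z = 0) → 1 ≤ n) ∧
      (∮ z in C(c, R), logDeriv F z) = 2 * π * I * n := by
  obtain ⟨p, hp⟩ : (sphere c R).Nonempty := NormedSpace.sphere_nonempty.2 hR.le
  have hfin : (closedBall c R \ F ⁻¹' {0}ᶜ).Finite :=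
    (isCompact_closedBall c R).finite_sdiff_of_mem_codiscreteWithin <|
      codiscreteWithin_mono (subset_univ _) <|
        AnalyticOnNhd.preimage_zero_mem_codiscrete (fun z _ => hF.analyticAt z) (hc p hp)
  have hzeros : ∀ z ∈ closedBall c R, F z = 0 → z ∈ hfin.toFinset := by
    intro z hz hFz
    simpa [hFz] using hz
  generalize hfin.toFinset = s at hzeros
  clear hfin
  induction s using Finset.induction_on generalizing F with
  | empty =>
    have hne : ∀ z ∈ closedBall c R, F z ≠ 0 := fun z hz h => by simpa using hzeros z hz h
    refine ⟨0, fun ⟨z, hz, h⟩ => (hne z (ball_subset_closedBall hz) h).elim, ?_⟩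
    simp [hF.circleIntegral_logDeriv_eq_zero hR.le hne]
  | insert a t _ ih =>
    by_cases hFa : a ∈ closedBall c R ∧ F a = 0
    · obtain ⟨haR, hFa⟩ := hFa
      have ha : a ∈ ball c R := by
        rw [← sphere_union_ball] at haR
        exact haR.resolve_left fun h => hc a h hFa
      have hnz : ¬ ∀ᶠ z in 𝓝 a, F z = 0 := fun h => hc p hp <|
        (show AnalyticOnNhd ℂ F univ from fun z _ =>
          hF.analyticAt z).eqOn_zero_of_preconnected_of_eventuallyEq_zero
          isPreconnected_univ (mem_univ a) h (mem_univ p)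
      obtain ⟨k, G, hG, hGa, hFG⟩ := hF.exists_eq_pow_mul hnz
      have hk : 1 ≤ k := by
        rw [Nat.one_le_iff_ne_zero]
        rintro rfl
        exact hGa (by simpa [hFa] using (hFG a).symm)
      have hGF : ∀ z, G z = 0 → F z = 0 := fun z hz => by rw [hFG, hz, mul_zero]
      have hGc : ∀ z ∈ sphere c R, G z ≠ 0 := fun z hz h => hc z hz (hGF z h)
      obtain ⟨n, -, hn⟩ := ih hG hGc fun z hz h =>
        (Finset.mem_insert.1 (hzeros z hz (hGF z h))).resolve_left fun e => hGa (e ▸ h)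
      refine ⟨k + n, fun _ => by omega, ?_⟩
      have hza : ∀ z ∈ sphere c R, z - a ≠ 0 := fun z hz h =>
        hc z hz (by rw [sub_eq_zero.1 h, hFa])
      have hlog : EqOn (logDeriv F) (fun z => (k : ℂ) * (z - a)⁻¹ + logDeriv G z)
          (sphere c R) := by
        intro z hz
        rw [show F = fun z => (z - a) ^ k * G z from funext hFG,
          logDeriv_mul (f := fun w => (w - a) ^ k) z (pow_ne_zero _ (hza z hz)) (hGc z hz)
            (by fun_prop) (hG z),
          logDeriv_fun_pow (by fun_prop)]
        simp [logDeriv_apply]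
      have hint : CircleIntegrable (fun z => (k : ℂ) * (z - a)⁻¹) c R :=
        ContinuousOn.circleIntegrable hR.le <|
          continuousOn_const.mul <| ContinuousOn.inv₀ (by fun_prop) hza
      rw [circleIntegral.integral_congr hR.le hlog,
        circleIntegral.integral_add hint (hG.circleIntegrable_logDeriv hR.le hGc),
        circleIntegral.integral_const_mul, circleIntegral.integral_sub_inv_of_mem_ball ha, hn]
      push_cast
      ring
    · exact ih hF hc fun z hz h => (Finset.mem_insert.1 (hzeros z hz h)).resolve_left
        fun e => hFa (e ▸ ⟨hz, h⟩)

/-- For entire `h₁₁, h₁₂, h₂₁, h₂₂` with nonvanishing determinant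
`d = h₁₁h₂₂ - h₁₂h₂₁`, `h₁₂(0) = 0`, and `h₁₁, h₁₂` nonvanishing on the unit circle,
the winding number of `f = d/(h₁₁·h₁₂)` along the unit circle is a negative integer. -/
theorem winding_of_difference_of_canonical_solutions_negative
    (h₁₁ h₁₂ h₂₁ h₂₂ : ℂ → ℂ)
    (H₁₁ : Differentiable ℂ h₁₁) (H₁₂ : Differentiable ℂ h₁₂)
    (H₂₁ : Differentiable ℂ h₂₁) (H₂₂ : Differentiable ℂ h₂₂)
    (hdet : ∀ z : ℂ, h₁₁ z * h₂₂ z - h₁₂ z * h₂₁ z ≠ 0)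
    (h120 : h₁₂ 0 = 0)
    (h11c : ∀ z : ℂ, ‖z‖ = 1 → h₁₁ z ≠ 0)
    (h12c : ∀ z : ℂ, ‖z‖ = 1 → h₁₂ z ≠ 0) :
    ∃ n : ℕ, 1 ≤ n ∧
      (1 / (2 * (π : ℂ) * Complex.I)) *
          (∮ z in C(0, 1),
            deriv (fun w : ℂ => (h₁₁ w * h₂₂ w - h₁₂ w * h₂₁ w) / (h₁₁ w * h₁₂ w)) z /
              ((h₁₁ z * h₂₂ z - h₁₂ z * h₂₁ z) / (h₁₁ z * h₁₂ z))) =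
        -(n : ℂ) := by
  have hd : Differentiable ℂ fun w => h₁₁ w * h₂₂ w - h₁₂ w * h₂₁ w :=
    (H₁₁.mul H₂₂).sub (H₁₂.mul H₂₁)
  have hF : Differentiable ℂ fun w => h₁₁ w * h₁₂ w := H₁₁.mul H₁₂
  have hFc : ∀ z ∈ sphere (0 : ℂ) 1, h₁₁ z * h₁₂ z ≠ 0 := fun z hz =>
    mul_ne_zero (h11c z (by simpa using hz)) (h12c z (by simpa using hz))
  obtain ⟨n, hn, hint⟩ := hF.exists_circleIntegral_logDeriv_eq one_pos hFc
  refine ⟨n, hn ⟨0, by simp, by simp [h120]⟩, ?_⟩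
  have hlog := circleIntegral.integral_congr zero_le_one fun z (hz : z ∈ sphere (0 : ℂ) 1) =>
    logDeriv_div z (hdet z) (hFc z hz) (hd z) (hF z)
  simp only [logDeriv_apply (fun z => _ / _)] at hlog
  rw [hlog, circleIntegral.integral_sub
      (hd.circleIntegrable_logDeriv zero_le_one fun z _ => hdet z)
      (hF.circleIntegrable_logDeriv zero_le_one hFc),
    hd.circleIntegral_logDeriv_eq_zero zero_le_one fun z _ => hdet z, hint]
  field_simp [two_pi_I_ne_zero]
  simp
end
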